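/- Let N ∈ [1,∞), let (X,d,m) be a CD*(0,N) metric measure space having the good transport property (GT), let mu, nu ∈ P2(X), assume mu <= C*m for some constant C > 0, and let pi ∈ OptGeo(mu,nu) be the unique optimal geodesic plan from mu to nu. Then for every t ∈ [0,1) one has (e_t)#pi <= C*(1-t)^{-N}*m. -/

import Mathlib

open MeasureTheory Metric Set unitInterval ENNReal NNReal

noncomputable section

variable {X : Type*} [MetricSpace X]

/-- A constant speed minimizing geodesic parametrized on `[0,1]`. -/
def IsUnitGeodesic (γ : C(unitInterval, X)) : Prop :=
  ∀ s t : unitInterval, dist (γ s) (γ t) = |(s : ℝ) - (t : ℝ)| * dist (γ 0) (γ 1)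

/-- The space of constant speed minimizing geodesics, with the sup distance. -/
def Geo (X : Type*) [MetricSpace X] : Type _ :=
  { γ : C(unitInterval, X) // IsUnitGeodesic γ }

instance : MetricSpace (Geo X) := Subtype.metricSpace
instance : MeasurableSpace (Geo X) := borel _
instance : BorelSpace (Geo X) := ⟨rfl⟩

/-- Evaluation map `e_t`. -/
def eval (t : unitInterval) (γ : Geo X) : X := γ.1 t

/-- `(X,d)` is a geodesic space: any two points are joined by a geodesic. -/
def IsGeodesicSpace (X : Type*) [MetricSpace X] : Prop :=
  ∀ x y : X, ∃ γ : Geo X, eval 0 γ = x ∧ eval 1 γ = y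

/-- The (topological) support of a measure. -/
def measSupport {Y : Type*} [TopologicalSpace Y] [MeasurableSpace Y] (μ : Measure Y) : Set Y :=
  {y | ∀ U ∈ nhds y, 0 < μ U}

variable [MeasurableSpace X]

/-- Finite second moment. -/
def HasFiniteSecondMoment (μ : Measure X) : Prop :=
  ∃ x₀ : X, ∫⁻ x, ENNReal.ofReal (dist x x₀ ^ 2) ∂μ ≠ ⊤

/-- The transport cost of a plan on the space of geodesics. -/
def transportCost (π : Measure (Geo X)) : ℝ≥0∞ :=
  ∫⁻ γ, ENNReal.ofReal (dist (eval 0 γ) (eval 1 γ) ^ 2) ∂π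

/-- `π ∈ OptGeo(μ,ν)`: an optimal geodesic plan from `μ` to `ν`. -/
def IsOptGeo (μ ν : Measure X) (π : Measure (Geo X)) : Prop :=
  IsProbabilityMeasure π ∧ π.map (eval 0) = μ ∧ π.map (eval 1) = ν ∧
    ∀ π' : Measure (Geo X), IsProbabilityMeasure π' →
      π'.map (eval 0) = μ → π'.map (eval 1) = ν →
      transportCost π ≤ transportCost π'

/-- The distortion coefficients `σ_{K,N}^{(t)}(θ)`. -/
def sigmaCoeff (K N t θ : ℝ) : ℝ≥0∞ :=
  if N * Real.pi ^ 2 ≤ K * θ ^ 2 then ⊤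
  else if 0 < K * θ ^ 2 then
    ENNReal.ofReal (Real.sin (t * θ * Real.sqrt (K / N)) / Real.sin (θ * Real.sqrt (K / N)))
  else if K * θ ^ 2 = 0 then ENNReal.ofReal t
  else ENNReal.ofReal (Real.sinh (t * θ * Real.sqrt (-K / N)) / Real.sinh (θ * Real.sqrt (-K / N)))

/-- The distortion coefficients `τ_{K,N}^{(t)}(θ)`. -/
def tauCoeff (K N t θ : ℝ) : ℝ≥0∞ :=
  if N = 1 then
    (if K ≤ 0 then ENNReal.ofReal t else if θ = 0 then ENNReal.ofReal t else ⊤)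
  else ENNReal.ofReal t ^ (1 / N) * sigmaCoeff K (N - 1) t θ ^ ((N - 1) / N)

/-- The (reduced) curvature dimension condition `CD*(K,N)`. -/
def IsCDStar (K N : ℝ) (m : Measure X) : Prop :=
  ∀ μ₀ μ₁ : Measure X, IsProbabilityMeasure μ₀ → IsProbabilityMeasure μ₁ →
    (∃ s : Set X, Bornology.IsBounded s ∧ μ₀ sᶜ = 0 ∧ μ₁ sᶜ = 0) →
    ∃ π : Measure (Geo X), IsOptGeo μ₀ μ₁ π ∧
      ∀ t : unitInterval, ∀ N' : ℝ, N ≤ N' →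
        ∫⁻ γ, (sigmaCoeff K N' (1 - (t : ℝ)) (dist (eval 0 γ) (eval 1 γ)) *
                 ((π.map (eval 0)).rnDeriv m (eval 0 γ)) ^ (-(1 / N')) +
               sigmaCoeff K N' (t : ℝ) (dist (eval 0 γ) (eval 1 γ)) *
                 ((π.map (eval 1)).rnDeriv m (eval 1 γ)) ^ (-(1 / N'))) ∂π
          ≤ ∫⁻ x, ((π.map (eval t)).rnDeriv m x) ^ (1 - 1 / N') ∂m

/-- The good transport property (GT): between absolutely continuous measures in `P₂(X)` there is
a unique optimal geodesic plan, and it is induced by a map from every intermediate time. -/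
def GoodTransport (m : Measure X) : Prop :=
  ∀ μ ν : Measure X, IsProbabilityMeasure μ → IsProbabilityMeasure ν →
    HasFiniteSecondMoment μ → HasFiniteSecondMoment ν → μ ≪ m → ν ≪ m →
    (∃! π : Measure (Geo X), IsOptGeo μ ν π) ∧
    ∀ π : Measure (Geo X), IsOptGeo μ ν π → ∀ t : unitInterval,
      ∃ T : X → Geo X, Measurable T ∧ π = (π.map (eval t)).map T

/-- `c`-concavity (with `c = d²/2`) for functions with values in `ℝ ∪ {-∞}`. -/
def cConcave (φ : X → EReal) : Prop :=
  (∃ x, φ x ≠ ⊥) ∧ (∀ x, φ x ≠ ⊤) ∧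
    ∃ ψ : X → EReal, (∀ y, ψ y ≠ ⊤) ∧
      ∀ x, φ x = ⨅ y, ((dist x y ^ 2 / 2 : ℝ) : EReal) - ψ y

/-- The `c`-transform `φᶜ`. -/
def cTransform (φ : X → EReal) : X → EReal :=
  fun y => ⨅ x, ((dist x y ^ 2 / 2 : ℝ) : EReal) - φ x

/-- The `c`-superdifferential `∂ᶜφ`. -/
def cSuperdiff (φ : X → EReal) : Set (X × X) :=
  {p | φ p.1 + cTransform φ p.2 = ((dist p.1 p.2 ^ 2 / 2 : ℝ) : EReal)}

/-- Kantorovich potential from `μ` to `ν`. -/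
def IsKantorovichPotential (μ ν : Measure X) (φ : X → EReal) : Prop :=
  cConcave φ ∧ ∀ π : Measure (Geo X), IsOptGeo μ ν π →
    measSupport (π.map (fun γ => (eval 0 γ, eval 1 γ))) ⊆ cSuperdiff φ

set_option linter.unusedSectionVars false
set_option linter.unusedSimpArgs false
set_option linter.unusedVariables false

section MeasureLemmas

/-- The functional `∫ ρ^p dm`. -/
def FF {α : Type*} [MeasurableSpace α] (m : Measure α) (p : ℝ) (μ : Measure α) : ℝ≥0∞ :=
  ∫⁻ x, (μ.rnDeriv m x) ^ p ∂m

variable {α β : Type*} [MeasurableSpace α] [MeasurableSpace β]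

theorem lift_sub {e : β → α} (he : Measurable e) (π : Measure β) [IsFiniteMeasure π]
    (γ : Measure α) (h : γ ≤ π.map e) : ∃ π' ≤ π, π'.map e = γ := by
  have : IsFiniteMeasure (π.map e) := inferInstance
  have : IsFiniteMeasure γ := isFiniteMeasure_of_le _ h
  have hle := Measure.rnDeriv_le_one_of_le h
  have hm : Measurable (γ.rnDeriv (π.map e)) := Measure.measurable_rnDeriv _ _
  refine ⟨π.withDensity (fun x => γ.rnDeriv (π.map e) (e x)), ?_, ?_⟩
  · refine Measure.le_iff.2 fun s hs => ?_
    rw [withDensity_apply _ hs]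
    have h2 : ∀ᵐ x ∂π, γ.rnDeriv (π.map e) (e x) ≤ 1 := ae_of_ae_map he.aemeasurable hle
    calc _ ≤ ∫⁻ x in s, 1 ∂π := lintegral_mono_ae (ae_restrict_of_ae h2)
      _ = π s := by simp
  · ext s hs
    rw [Measure.map_apply he hs, withDensity_apply _ (he hs), ← setLIntegral_map hs hm he,
      ← withDensity_apply _ hs, Measure.withDensity_rnDeriv_eq _ _ (Measure.absolutelyContinuous_of_le h)]

theorem common_sub {e : β → α} (he : Measurable e) (π₁ π₂ : Measure β) [IsFiniteMeasure π₁]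
    [IsFiniteMeasure π₂] (h : ¬ (π₁.map e ⟂ₘ π₂.map e)) :
    ∃ a ≤ π₁, ∃ b ≤ π₂, a.map e = b.map e ∧ a.map e ≠ 0 := by
  rw [Measure.mutuallySingular_iff_disjoint, disjoint_iff] at h
  obtain ⟨a, ha, hae⟩ := lift_sub he π₁ (π₁.map e ⊓ π₂.map e) inf_le_left
  obtain ⟨b, hb, hbe⟩ := lift_sub he π₂ (π₁.map e ⊓ π₂.map e) inf_le_right
  exact ⟨a, ha, b, hb, hae.trans hbe.symm, by rw [hae]; exact h⟩

variable (m : Measure α) [SigmaFinite m]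

theorem FF_smul {p : ℝ} (hp : 0 ≤ p) (μ : Measure α) [IsFiniteMeasure μ] {c : ℝ≥0∞} (hc : c ≠ ⊤) :
    FF m p (c • μ) = c ^ p * FF m p μ := by
  unfold FF
  rw [← lintegral_const_mul _ ((Measure.measurable_rnDeriv _ _).pow_const _)]
  refine lintegral_congr_ae ?_
  filter_upwards [Measure.rnDeriv_smul_left_of_ne_top' μ m hc] with x hx
  rw [hx]; simp [ENNReal.mul_rpow_of_nonneg _ _ hp]

theorem rnDeriv_zero_of_null (μ : Measure α) {s : Set α} (hs : MeasurableSet s) (h : μ s = 0) :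
    ∀ᵐ x ∂m, x ∈ s → μ.rnDeriv m x = 0 := by
  have h1 : ∫⁻ x in s, μ.rnDeriv m x ∂m = 0 :=
    le_antisymm ((Measure.setLIntegral_rnDeriv_le s).trans h.le) bot_le
  rw [lintegral_eq_zero_iff (Measure.measurable_rnDeriv _ _)] at h1
  exact (ae_restrict_iff' hs).1 h1

theorem FF_add {p : ℝ} (hp : 0 < p) (μ ν : Measure α) [IsFiniteMeasure μ] [IsFiniteMeasure ν]
    (h : μ ⟂ₘ ν) : FF m p (μ + ν) = FF m p μ + FF m p ν := by
  unfold FF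
  rw [← lintegral_add_left ((Measure.measurable_rnDeriv _ _).pow_const _)]
  refine lintegral_congr_ae ?_
  obtain ⟨s, hs, h1, h2⟩ := h
  filter_upwards [Measure.rnDeriv_add' μ ν m, rnDeriv_zero_of_null m μ hs h1,
    rnDeriv_zero_of_null m ν hs.compl h2] with x hx a b
  rw [hx]
  by_cases hxs : x ∈ s
  · simp [a hxs, ENNReal.zero_rpow_of_pos hp]
  · simp [b hxs, ENNReal.zero_rpow_of_pos hp]

theorem FF_le {p : ℝ} (hp : 0 < p) (hp1 : p < 1) (μ : Measure α) {s : Set α}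
    (hs : MeasurableSet s) (h : μ sᶜ = 0) : FF m p μ ≤ (μ univ) ^ p * (m s) ^ (1 - p) := by
  have h1 : FF m p μ = ∫⁻ x, (μ.rnDeriv m x) ^ p * (s.indicator 1 x) ^ (1 - p) ∂m := by
    refine lintegral_congr_ae ?_
    filter_upwards [rnDeriv_zero_of_null m μ hs.compl h] with x hx
    by_cases hxs : x ∈ s
    · simp [hxs]
    · simp [hx hxs, ENNReal.zero_rpow_of_pos hp]
  rw [h1]
  refine (ENNReal.lintegral_mul_norm_pow_le (Measure.measurable_rnDeriv _ _).aemeasurable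
    (measurable_one.indicator hs).aemeasurable hp.le (by linarith) (by ring)).trans ?_
  gcongr
  · exact Measure.lintegral_rnDeriv_le
  · rw [lintegral_indicator_one hs]

theorem FF_ne_zero {p : ℝ} (hp : 0 < p) (μ : Measure α) [IsFiniteMeasure μ] (hac : μ ≪ m)
    (h : μ ≠ 0) : FF m p μ ≠ 0 := by
  intro h0
  unfold FF at h0
  rw [lintegral_eq_zero_iff ((Measure.measurable_rnDeriv _ _).pow_const _)] at h0
  apply h
  rw [← Measure.withDensity_rnDeriv_eq μ m hac]
  rw [withDensity_eq_zero_iff (Measure.measurable_rnDeriv _ _).aemeasurable]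
  filter_upwards [h0] with x hx
  simpa [ENNReal.rpow_eq_zero_iff, hp, hp.not_gt] using hx

theorem FF_eq (q : ℝ) (hq1 : q < 1) (μ : Measure α) [IsFiniteMeasure μ]
    (hac : μ ≪ m) : ∫⁻ x, (μ.rnDeriv m x) ^ (-q) ∂μ = FF m (1 - q) μ := by
  rw [← lintegral_rnDeriv_mul hac ((Measure.measurable_rnDeriv _ _).pow_const _).aemeasurable]
  refine lintegral_congr_ae ?_
  filter_upwards [Measure.rnDeriv_lt_top μ m] with x hx
  by_cases h0 : μ.rnDeriv m x = 0
  · rw [h0, zero_mul, ENNReal.zero_rpow_of_pos (by linarith)]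
  · rw [sub_eq_add_neg, ENNReal.rpow_add _ _ h0 hx.ne, ENNReal.rpow_one]

theorem FF_tendsto (μ : Measure α) [IsFiniteMeasure μ] {s : Set α}
    (hs : MeasurableSet s) (hms : m s ≠ ⊤) (h : μ sᶜ = 0) :
    Filter.Tendsto (fun n : ℕ => FF m (1 - 1 / ((n : ℝ) + 2)) μ) Filter.atTop
      (nhds (∫⁻ x, μ.rnDeriv m x ∂m)) := by
  have hlim : Filter.Tendsto (fun n : ℕ => (1 - 1 / ((n : ℝ) + 2))) Filter.atTop (nhds 1) := by
    have : Filter.Tendsto (fun n : ℕ => ((n : ℝ) + 2)) Filter.atTop Filter.atTop :=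
      Filter.tendsto_atTop_add_const_right _ _ tendsto_natCast_atTop_atTop
    have := (this.const_div_atTop 1).const_sub 1
    simpa using this
  have hpos : ∀ n : ℕ, 0 < (1 - 1 / ((n : ℝ) + 2)) := fun n => by
    have : (0 : ℝ) ≤ n := n.cast_nonneg
    rw [sub_pos, div_lt_one (by linarith)]; linarith
  have hle : ∀ n : ℕ, (1 - 1 / ((n : ℝ) + 2)) ≤ 1 := fun n => by
    have : (0 : ℝ) ≤ 1 / ((n : ℝ) + 2) := by positivity
    linarith
  refine tendsto_lintegral_of_dominated_convergence (fun x => s.indicator 1 x + μ.rnDeriv m x)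
    (fun n => (Measure.measurable_rnDeriv _ _).pow_const _) (fun n => ?_) ?_ ?_
  · filter_upwards [rnDeriv_zero_of_null m μ hs.compl h] with x hx
    by_cases hxs : x ∈ s
    · simp only [hxs, indicator_of_mem, Pi.one_apply]
      rcases le_total (μ.rnDeriv m x) 1 with h1 | h1
      · exact (ENNReal.rpow_le_one h1 (hpos n).le).trans le_self_add
      · calc _ ≤ (μ.rnDeriv m x) ^ (1 : ℝ) := ENNReal.rpow_le_rpow_of_exponent_le h1 (hle n)
          _ ≤ _ := by rw [ENNReal.rpow_one]; exact le_add_self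
    · rw [hx hxs, ENNReal.zero_rpow_of_pos (hpos n)]; exact bot_le
  · rw [lintegral_add_left (measurable_one.indicator hs), lintegral_indicator_one hs]
    exact ENNReal.add_ne_top.2 ⟨hms, (Measure.lintegral_rnDeriv_lt_top _ _).ne⟩
  · filter_upwards [Measure.rnDeriv_lt_top μ m] with x hx
    by_cases h0 : μ.rnDeriv m x = 0
    · simp only [h0, ENNReal.zero_rpow_of_pos (hpos _)]; exact tendsto_const_nhds
    · obtain ⟨c, hc⟩ : ∃ c : ℝ≥0, (c : ℝ≥0∞) = μ.rnDeriv m x := ⟨_, ENNReal.coe_toNNReal hx.ne⟩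
      have hc0 : c ≠ 0 := by rintro rfl; exact h0 (by simp [← hc])
      have h1 : Filter.Tendsto (fun n : ℕ => c ^ (1 - 1 / ((n : ℝ) + 2))) Filter.atTop
          (nhds (c ^ (1 : ℝ))) := tendsto_const_nhds.nnrpow hlim (Or.inl hc0)
      rw [← hc]
      simp only [← ENNReal.coe_rpow_of_ne_zero hc0]
      rw [NNReal.rpow_one] at h1
      exact ENNReal.tendsto_coe.2 h1

theorem ac_of_mass (μ : Measure α) [IsFiniteMeasure μ]
    (h : μ univ ≤ ∫⁻ x, μ.rnDeriv m x ∂m) : μ ≪ m := by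
  have h1 := Measure.haveLebesgueDecomposition_add μ m
  have h2 : μ univ = μ.singularPart m univ + ∫⁻ x, μ.rnDeriv m x ∂m := by
    conv_lhs => rw [h1]
    simp
  have hfin : ∫⁻ x, μ.rnDeriv m x ∂m ≠ ⊤ := (Measure.lintegral_rnDeriv_lt_top _ _).ne
  have h3 : μ.singularPart m univ = 0 := by
    rw [h2] at h
    have h5 : μ.singularPart m univ + ∫⁻ x, μ.rnDeriv m x ∂m ≤ 0 + ∫⁻ x, μ.rnDeriv m x ∂m := by
      simpa using h
    exact le_antisymm ((ENNReal.add_le_add_iff_right hfin).1 h5) bot_le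
  have h4 := Measure.measure_univ_eq_zero.1 h3
  rw [h1, h4, zero_add]
  exact withDensity_absolutelyContinuous _ _

end MeasureLemmas

section GeoInfra

theorem continuous_eval (t : unitInterval) : Continuous (eval t : Geo X → X) :=
  (continuous_eval_const t).comp continuous_subtype_val

theorem measurable_eval [BorelSpace X] (t : unitInterval) : Measurable (eval t : Geo X → X) :=
  (continuous_eval t).measurable

theorem measurable_cost : Measurable
    (fun γ : Geo X => ENNReal.ofReal (dist (eval 0 γ) (eval 1 γ) ^ 2)) :=
  (ENNReal.continuous_ofReal.comp
    (((continuous_eval 0).dist (continuous_eval 1)).pow 2)).measurable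

theorem geo_dist (γ : Geo X) (s t : unitInterval) :
    dist (eval s γ) (eval t γ) = |(s : ℝ) - t| * dist (eval 0 γ) (eval 1 γ) := γ.2 s t

/-- Restriction of a geodesic to `[0,b]`. -/
def rest (b : unitInterval) (γ : Geo X) : Geo X :=
  ⟨γ.1.comp ⟨fun s => b * s, by fun_prop⟩, by
    intro s t
    have h1 := γ.2 (b * s) (b * t)
    have h2 := γ.2 (b * 0) (b * 1)
    simp only [ContinuousMap.comp_apply, ContinuousMap.coe_mk]
    rw [h1, h2]
    have hb : (0 : ℝ) ≤ b := b.2.1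
    simp only [Set.Icc.coe_mul, Set.Icc.coe_zero, Set.Icc.coe_one, mul_zero, mul_one, zero_sub,
      abs_neg, abs_of_nonneg hb, ← mul_sub, abs_mul]
    ring⟩

theorem eval_rest (b s : unitInterval) (γ : Geo X) : eval s (rest b γ) = eval (b * s) γ := rfl

theorem measurable_rest (b : unitInterval) : Measurable (rest b : Geo X → Geo X) := by
  apply Continuous.measurable
  exact Continuous.subtype_mk ((ContinuousMap.continuous_precomp _).comp continuous_subtype_val) _

/-- Time reversal. -/
def rev (γ : Geo X) : Geo X :=
  ⟨γ.1.comp ⟨unitInterval.symm, unitInterval.continuous_symm⟩, by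
    intro s t
    have h1 := γ.2 (unitInterval.symm s) (unitInterval.symm t)
    have h2 := γ.2 (unitInterval.symm 0) (unitInterval.symm 1)
    simp only [ContinuousMap.comp_apply, ContinuousMap.coe_mk]
    rw [h1, h2]
    simp only [unitInterval.coe_symm_eq, Set.Icc.coe_zero, Set.Icc.coe_one]
    rw [show (1 - (s : ℝ) - (1 - t)) = -(s - t) by ring, abs_neg]
    norm_num⟩

theorem eval_rev (s : unitInterval) (γ : Geo X) : eval s (rev γ) = eval (unitInterval.symm s) γ :=
  rfl

theorem measurable_rev : Measurable (rev : Geo X → Geo X) := by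
  apply Continuous.measurable
  exact Continuous.subtype_mk ((ContinuousMap.continuous_precomp _).comp continuous_subtype_val) _

theorem rev_rev (γ : Geo X) : rev (rev γ) = γ := by
  apply Subtype.ext
  ext s
  simp [rev]

/-- Bounded plan. -/
def BddPlan (π : Measure (Geo X)) : Prop :=
  ∃ (x : X) (R : ℝ), ∀ᵐ γ ∂π, dist (eval 0 γ) x ≤ R ∧ dist (eval 1 γ) x ≤ R

/-- Optimal (not normalized) bounded plan. -/
def MOpt (π : Measure (Geo X)) : Prop :=
  IsFiniteMeasure π ∧ BddPlan π ∧ ∀ π' : Measure (Geo X), π'.map (eval 0) = π.map (eval 0) →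
    π'.map (eval 1) = π.map (eval 1) → transportCost π ≤ transportCost π'

variable [BorelSpace X]

theorem mass_map {β γ : Type*} [MeasurableSpace β] [MeasurableSpace γ] (π : Measure β) {f : β → γ}
    (hf : Measurable f) :
    π.map f univ = π univ := by
  rw [Measure.map_apply hf MeasurableSet.univ, preimage_univ]

theorem mass_eq {π π' : Measure (Geo X)} {s t : unitInterval}
    (h : π.map (eval s) = π'.map (eval t)) : π univ = π' univ := by
  rw [← mass_map π (measurable_eval s), h, mass_map π' (measurable_eval t)]

theorem finite_of_eq {π π' : Measure (Geo X)} [IsFiniteMeasure π'] {s t : unitInterval}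
    (h : π.map (eval s) = π'.map (eval t)) : IsFiniteMeasure π :=
  ⟨by rw [mass_eq h]; exact measure_lt_top _ _⟩

theorem zero_of_map {β γ : Type*} [MeasurableSpace β] [MeasurableSpace γ] {π : Measure β} {f : β → γ}
    (hf : Measurable f) (h : π.map f = 0) : π = 0 := by
  rw [← Measure.measure_univ_eq_zero, ← mass_map π hf, h]; simp

theorem ae_map_eval {π : Measure (Geo X)} {t : unitInterval} {p : X → Prop}
    (hp : MeasurableSet {x | p x}) : (∀ᵐ γ ∂π, p (eval t γ)) ↔ ∀ᵐ x ∂(π.map (eval t)), p x :=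
  (ae_map_iff (measurable_eval t).aemeasurable hp).symm

theorem bdd_congr {π π' : Measure (Geo X)} (h0 : π'.map (eval 0) = π.map (eval 0))
    (h1 : π'.map (eval 1) = π.map (eval 1)) (h : BddPlan π) : BddPlan π' := by
  obtain ⟨x, R, h⟩ := h
  have hm : MeasurableSet {y : X | dist y x ≤ R} := isClosed_closedBall.measurableSet
  refine ⟨x, R, ?_⟩
  have ha : ∀ᵐ γ ∂π', dist (eval 0 γ) x ≤ R := by
    rw [ae_map_eval (p := fun y => dist y x ≤ R) hm, h0, ← ae_map_eval hm]
    exact h.mono fun _ h => h.1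
  have hb : ∀ᵐ γ ∂π', dist (eval 1 γ) x ≤ R := by
    rw [ae_map_eval (p := fun y => dist y x ≤ R) hm, h1, ← ae_map_eval hm]
    exact h.mono fun _ h => h.2
  filter_upwards [ha, hb] with γ h1 h2 using ⟨h1, h2⟩

theorem bdd_dist {π : Measure (Geo X)} (h : BddPlan π) :
    ∃ L : ℝ, 0 < L ∧ ∀ᵐ γ ∂π, dist (eval 0 γ) (eval 1 γ) ≤ L := by
  obtain ⟨x, R, h⟩ := h
  refine ⟨max (2 * R) 1, by positivity, h.mono fun γ hγ => ?_⟩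
  exact (dist_triangle_right _ _ x).trans (by linarith [hγ.1, hγ.2, le_max_left (2 * R) 1])

theorem cost_ne_top {π : Measure (Geo X)} [IsFiniteMeasure π] (h : BddPlan π) :
    transportCost π ≠ ⊤ := by
  obtain ⟨L, hL, h⟩ := bdd_dist h
  have : transportCost π ≤ ∫⁻ _, ENNReal.ofReal (L ^ 2) ∂π := by
    refine lintegral_mono_ae (h.mono fun γ hγ => ?_)
    gcongr
  refine ne_top_of_le_ne_top ?_ this
  rw [lintegral_const]
  exact ENNReal.mul_ne_top ENNReal.ofReal_ne_top (measure_ne_top _ _)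

theorem cost_add (π π' : Measure (Geo X)) :
    transportCost (π + π') = transportCost π + transportCost π' := lintegral_add_measure _ _ _

theorem cost_smul (c : ℝ≥0∞) (π : Measure (Geo X)) :
    transportCost (c • π) = c * transportCost π := by
  unfold transportCost; rw [lintegral_smul_measure]; rfl

theorem MOpt.sub {π π' : Measure (Geo X)} (h : MOpt π) (hle : π' ≤ π) : MOpt π' := by
  obtain ⟨hf, hb, ho⟩ := h
  have hf' : IsFiniteMeasure π' := isFiniteMeasure_of_le _ hle
  refine ⟨hf', ?_, fun θ h0 h1 => ?_⟩
  · obtain ⟨x, R, h⟩ := hb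
    exact ⟨x, R, Measure.absolutelyContinuous_of_le hle h⟩
  · have e := Measure.sub_add_cancel_of_le hle
    have := ho (π - π' + θ)
      (by rw [Measure.map_add _ _ (measurable_eval _), h0,
            ← Measure.map_add _ _ (measurable_eval _), e])
      (by rw [Measure.map_add _ _ (measurable_eval _), h1,
            ← Measure.map_add _ _ (measurable_eval _), e])
    have hc := cost_ne_top hb
    rw [← e, cost_add] at hc
    nth_rw 1 [← e] at this
    rw [cost_add, cost_add] at this
    exact (ENNReal.add_le_add_iff_left (ENNReal.add_ne_top.1 hc).1).1 this

theorem MOpt.smul {π : Measure (Geo X)} (h : MOpt π) {c : ℝ≥0∞} (hc : c ≠ ⊤) : MOpt (c • π) := by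
  obtain ⟨hf, hb, ho⟩ := h
  by_cases hc0 : c = 0
  · subst hc0
    obtain ⟨x, R, h⟩ := hb
    refine ⟨by rw [zero_smul]; infer_instance, ⟨x, R, by simp⟩, fun θ h0 h1 => by
      simp [transportCost]⟩
  refine ⟨Measure.smul_finite _ hc, ?_, fun θ h0 h1 => ?_⟩
  · obtain ⟨x, R, h⟩ := hb
    exact ⟨x, R, Measure.ae_smul_measure h c⟩
  · have hcc : c⁻¹ * c = 1 := ENNReal.inv_mul_cancel hc0 hc
    have := ho (c⁻¹ • θ) (by rw [Measure.map_smul, h0, Measure.map_smul, smul_smul, hcc, one_smul])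
      (by rw [Measure.map_smul, h1, Measure.map_smul, smul_smul, hcc, one_smul])
    rw [cost_smul] at this ⊢
    calc c * transportCost π ≤ c * (c⁻¹ * transportCost θ) := by gcongr
      _ = transportCost θ := by rw [← mul_assoc, ENNReal.mul_inv_cancel hc0 hc, one_mul]

theorem MOpt.of_cost {π θ : Measure (Geo X)} (h : MOpt π) (h0 : θ.map (eval 0) = π.map (eval 0))
    (h1 : θ.map (eval 1) = π.map (eval 1)) (hc : transportCost θ ≤ transportCost π) : MOpt θ := by
  obtain ⟨hf, hb, ho⟩ := h
  exact ⟨finite_of_eq h0, bdd_congr h0 h1 hb, fun θ' a b =>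
    hc.trans (ho θ' (a.trans h0) (b.trans h1))⟩

theorem MOpt.swap {π₁ π₂ θ₁ θ₂ : Measure (Geo X)} (h : MOpt (π₁ + π₂))
    (hs₁ : MOpt θ₁) (hs₂ : MOpt θ₂)
    (h10 : θ₁.map (eval 0) = π₁.map (eval 0)) (h11 : θ₁.map (eval 1) = π₁.map (eval 1))
    (h20 : θ₂.map (eval 0) = π₂.map (eval 0)) (h21 : θ₂.map (eval 1) = π₂.map (eval 1)) :
    MOpt (θ₁ + θ₂) := by
  refine h.of_cost ?_ ?_ ?_
  · simp only [Measure.map_add _ _ (measurable_eval _), h10, h20]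
  · simp only [Measure.map_add _ _ (measurable_eval _), h11, h21]
  · rw [cost_add, cost_add]
    exact add_le_add (hs₁.2.2 _ h10.symm h11.symm) (hs₂.2.2 _ h20.symm h21.symm)

theorem IsOptGeo.mopt {μ ν : Measure X} {π : Measure (Geo X)} (h : IsOptGeo μ ν π)
    (hb : BddPlan π) : MOpt π := by
  obtain ⟨hp, h0, h1, ho⟩ := h
  refine ⟨inferInstance, hb, fun θ a b => ho θ ⟨?_⟩ (a.trans h0) (b.trans h1)⟩
  rw [mass_eq a]; exact measure_univ

theorem MOpt.isOptGeo {π : Measure (Geo X)} (h : MOpt π) (h0 : π ≠ 0) :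
    IsOptGeo (((π univ)⁻¹ • π).map (eval 0)) (((π univ)⁻¹ • π).map (eval 1))
      ((π univ)⁻¹ • π) := by
  have hf := h.1
  have hne : π univ ≠ 0 := by simpa using h0
  have h' := h.smul (c := (π univ)⁻¹) (ENNReal.inv_ne_top.2 hne)
  refine ⟨⟨?_⟩, rfl, rfl, fun θ _ a b => h'.2.2 θ a b⟩
  simp [ENNReal.inv_mul_cancel hne (measure_ne_top _ _)]

theorem MOpt.rev {π : Measure (Geo X)} (h : MOpt π) : MOpt (π.map rev) := by
  have hf := h.1
  have ev : ∀ (θ : Measure (Geo X)) t, (θ.map _root_.rev).map (eval t)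
      = θ.map (eval (unitInterval.symm t)) := fun θ t => by
    rw [Measure.map_map (measurable_eval t) measurable_rev]; rfl
  have ec : ∀ θ : Measure (Geo X), transportCost (θ.map _root_.rev) = transportCost θ := fun θ => by
    unfold transportCost
    rw [lintegral_map measurable_cost measurable_rev]
    simp [eval_rev, dist_comm]
  refine ⟨inferInstance, ?_, fun θ h0 h1 => ?_⟩
  · obtain ⟨x, R, hb⟩ := h.2.1
    refine ⟨x, R, ?_⟩
    rw [ae_map_iff measurable_rev.aemeasurable]
    · filter_upwards [hb] with γ hγ
      simpa [eval_rev] using hγ.symm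
    · exact ((isClosed_le ((continuous_eval 0).dist continuous_const) continuous_const).inter
        (isClosed_le ((continuous_eval 1).dist continuous_const) continuous_const)).measurableSet
  · rw [ec, ← ec θ]
    rw [ev] at h0 h1
    refine h.2.2 _ ?_ ?_
    · rw [ev]; simpa using h1
    · rw [ev]; simpa using h0

theorem map_eval_rest (π : Measure (Geo X)) (b t : unitInterval) :
    (π.map (rest b)).map (eval t) = π.map (eval (b * t)) := by
  rw [Measure.map_map (measurable_eval t) (measurable_rest b)]; rfl

theorem map_eval_rev (π : Measure (Geo X)) (t : unitInterval) :
    (π.map rev).map (eval t) = π.map (eval (unitInterval.symm t)) := by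
  rw [Measure.map_map (measurable_eval t) measurable_rev]; rfl

theorem bdd_eval {π : Measure (Geo X)} (h : BddPlan π) :
    ∃ (x : X) (R : ℝ), ∀ t, ∀ᵐ γ ∂π, eval t γ ∈ closedBall x R := by
  obtain ⟨x, R, h⟩ := h
  refine ⟨x, R + 2 * R, fun t => h.mono fun γ hγ => ?_⟩
  have h1 := geo_dist γ t 0
  have h2 : dist (eval 0 γ) (eval 1 γ) ≤ 2 * R :=
    (dist_triangle_right _ _ x).trans (by linarith [hγ.1, hγ.2])
  have ht0 : (0 : ℝ) ≤ t := t.2.1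
  have ht1 : (t : ℝ) ≤ 1 := t.2.2
  rw [Set.Icc.coe_zero, sub_zero, abs_of_nonneg ht0] at h1
  have h3 := dist_triangle (eval t γ) (eval 0 γ) x
  have h4 : (t : ℝ) * dist (eval 0 γ) (eval 1 γ) ≤ 1 * (2 * R) :=
    mul_le_mul ht1 h2 dist_nonneg zero_le_one
  rw [mem_closedBall]
  linarith [hγ.1]

end GeoInfra

section Gluing

variable [BorelSpace X]

/-- Existence of optimal geodesic plans between bounded measures. -/
def HasPlans (X : Type*) [MetricSpace X] [MeasurableSpace X] : Prop :=
  ∀ μ₀ μ₁ : Measure X, IsProbabilityMeasure μ₀ → IsProbabilityMeasure μ₁ →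
    (∃ s : Set X, Bornology.IsBounded s ∧ μ₀ sᶜ = 0 ∧ μ₁ sᶜ = 0) →
    ∃ π : Measure (Geo X), IsOptGeo μ₀ μ₁ π

theorem lift_piece (hE : HasPlans X) (η : Measure (X × X)) [IsFiniteMeasure η] {δ : ℝ} (hδ : 0 < δ)
    {A B : Set X} (hA : MeasurableSet A) (hB : MeasurableSet B)
    (hA' : ∀ x ∈ A, ∀ y ∈ A, dist x y ≤ δ) (hB' : ∀ x ∈ B, ∀ y ∈ B, dist x y ≤ δ)
    (hη : ∀ᵐ p ∂η, p.1 ∈ A ∧ p.2 ∈ B) :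
    ∃ π : Measure (Geo X), π.map (eval 0) = η.map Prod.fst ∧ π.map (eval 1) = η.map Prod.snd ∧
      transportCost π ≤ ∫⁻ p, ENNReal.ofReal ((dist p.1 p.2 + 2 * δ) ^ 2) ∂η := by
  by_cases h0 : η = 0
  · exact ⟨0, by simp [h0], by simp [h0], by simp [transportCost]⟩
  have hw0 : η univ ≠ 0 := by simpa using h0
  have hwt : η univ ≠ ⊤ := measure_ne_top _ _
  set w := η univ with hw
  have hp : IsProbabilityMeasure (w⁻¹ • η) := ⟨by simp [← hw, ENNReal.inv_mul_cancel hw0 hwt]⟩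
  have ha : (η.map Prod.fst) Aᶜ = 0 := by
    rw [Measure.map_apply measurable_fst hA.compl]
    exact measure_mono_null (t := {p | ¬ (p.1 ∈ A ∧ p.2 ∈ B)}) (fun p hp h => hp h.1) hη
  have hb : (η.map Prod.snd) Bᶜ = 0 := by
    rw [Measure.map_apply measurable_snd hB.compl]
    exact measure_mono_null (t := {p | ¬ (p.1 ∈ A ∧ p.2 ∈ B)}) (fun p hp h => hp h.2) hη
  obtain ⟨π, hπp, h0, h1, -⟩ := hE ((w⁻¹ • η).map Prod.fst) ((w⁻¹ • η).map Prod.snd)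
    (Measure.isProbabilityMeasure_map measurable_fst.aemeasurable)
    (Measure.isProbabilityMeasure_map measurable_snd.aemeasurable)
    ⟨A ∪ B, (Metric.isBounded_iff.2 ⟨δ, fun x hx y hy => hA' x hx y hy⟩).union
      (Metric.isBounded_iff.2 ⟨δ, fun x hx y hy => hB' x hx y hy⟩), by
      rw [Measure.map_smul, Measure.smul_apply,
        measure_mono_null (compl_subset_compl.2 subset_union_left) ha]; simp, by
      rw [Measure.map_smul, Measure.smul_apply,
        measure_mono_null (compl_subset_compl.2 subset_union_right) hb]; simp⟩
  have hww : w * w⁻¹ = 1 := ENNReal.mul_inv_cancel hw0 hwt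
  refine ⟨w • π, by rw [Measure.map_smul, h0, Measure.map_smul, smul_smul, hww, one_smul],
    by rw [Measure.map_smul, h1, Measure.map_smul, smul_smul, hww, one_smul], ?_⟩
  have hae0 : ∀ᵐ γ ∂π, eval 0 γ ∈ A := by
    rw [ae_map_eval (p := fun x => x ∈ A) hA, h0, Measure.map_smul]
    exact Measure.ae_smul_measure ha _
  have hae1 : ∀ᵐ γ ∂π, eval 1 γ ∈ B := by
    rw [ae_map_eval (p := fun x => x ∈ B) hB, h1, Measure.map_smul]
    exact Measure.ae_smul_measure hb _
  rw [cost_smul]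
  calc w * transportCost π = ∫⁻ _, transportCost π ∂η := by rw [lintegral_const, mul_comm]
    _ ≤ _ := by
      refine lintegral_mono_ae (hη.mono fun p hp => ?_)
      calc transportCost π ≤ ∫⁻ _, ENNReal.ofReal ((dist p.1 p.2 + 2 * δ) ^ 2) ∂π := by
            refine lintegral_mono_ae ?_
            filter_upwards [hae0, hae1] with γ h0 h1
            gcongr
            have e1 := hA' _ h0 _ hp.1
            have e2 := hB' _ hp.2 _ h1
            have := dist_triangle4 (eval 0 γ) p.1 p.2 (eval 1 γ)
            linarith
        _ = _ := by simp

theorem exists_index [TopologicalSpace.SeparableSpace X] [Nonempty X] {δ : ℝ} (hδ : 0 < δ) :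
    ∃ q : X → ℕ, Measurable q ∧ ∀ x y, q x = q y → dist x y ≤ δ := by
  classical
  have h : ∀ x : X, ∃ n, x ∈ ball (TopologicalSpace.denseSeq X n) (δ / 2) := fun x => by
    obtain ⟨n, hn⟩ := (TopologicalSpace.denseRange_denseSeq X).exists_mem_open
      (isOpen_ball (x := x) (ε := δ / 2)) ⟨x, mem_ball_self (by positivity)⟩
    exact ⟨n, by rwa [mem_ball_comm]⟩
  refine ⟨fun x => Nat.find (h x), measurable_find h fun n => measurableSet_ball, fun x y hxy => ?_⟩
  have h1 := Nat.find_spec (h x)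
  have h2 := Nat.find_spec (h y)
  simp only at hxy
  rw [← hxy] at h2
  have := dist_triangle_right x y (TopologicalSpace.denseSeq X (Nat.find (h x)))
  rw [mem_ball] at h1 h2
  linarith

theorem lift_coupling [TopologicalSpace.SeparableSpace X] [Nonempty X] (hE : HasPlans X)
    (η : Measure (X × X)) [IsFiniteMeasure η] {δ : ℝ} (hδ : 0 < δ) :
    ∃ π : Measure (Geo X), π.map (eval 0) = η.map Prod.fst ∧ π.map (eval 1) = η.map Prod.snd ∧
      transportCost π ≤ ∫⁻ p, ENNReal.ofReal ((dist p.1 p.2 + 2 * δ) ^ 2) ∂η := by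
  obtain ⟨q, hq, hqd⟩ := exists_index (X := X) hδ
  let S : ℕ × ℕ → Set (X × X) := fun ij => {p | q p.1 = ij.1 ∧ q p.2 = ij.2}
  have hqm : ∀ i, MeasurableSet {x | q x = i} := fun i => hq (measurableSet_singleton i)
  have hS : ∀ ij, MeasurableSet (S ij) := fun ij =>
    (measurable_fst (hqm ij.1)).inter (measurable_snd (hqm ij.2))
  have hsum : Measure.sum (fun ij => η.restrict (S ij)) = η := by
    rw [← Measure.restrict_iUnion _ hS]
    · have : (⋃ ij, S ij) = univ := eq_univ_of_forall fun p =>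
        mem_iUnion.2 ⟨(q p.1, q p.2), rfl, rfl⟩
      rw [this, Measure.restrict_univ]
    · intro i j hij
      refine Set.disjoint_left.2 fun p hp hp' => hij ?_
      exact Prod.ext (hp.1.symm.trans hp'.1) (hp.2.symm.trans hp'.2)
  have := fun ij => lift_piece hE (η.restrict (S ij)) hδ (hqm ij.1) (hqm ij.2)
    (fun x hx y hy => hqd x y (hx.trans hy.symm)) (fun x hx y hy => hqd x y (hx.trans hy.symm))
    (ae_restrict_mem (hS ij))
  choose P h0 h1 hc using this
  refine ⟨Measure.sum P, ?_, ?_, ?_⟩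
  · rw [Measure.map_sum (measurable_eval 0).aemeasurable]
    simp only [h0]
    rw [← Measure.map_sum measurable_fst.aemeasurable, hsum]
  · rw [Measure.map_sum (measurable_eval 1).aemeasurable]
    simp only [h1]
    rw [← Measure.map_sum measurable_snd.aemeasurable, hsum]
  · conv_rhs => rw [← hsum]
    rw [lintegral_sum_measure]
    unfold transportCost
    rw [lintegral_sum_measure]
    exact ENNReal.tsum_le_tsum hc

theorem MOpt.le_coupling [TopologicalSpace.SeparableSpace X] [Nonempty X] (hE : HasPlans X)
    {π : Measure (Geo X)} (h : MOpt π) (η : Measure (X × X)) (h0 : η.map Prod.fst = π.map (eval 0))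
    (h1 : η.map Prod.snd = π.map (eval 1)) :
    transportCost π ≤ ∫⁻ p, ENNReal.ofReal (dist p.1 p.2 ^ 2) ∂η := by
  have hf := h.1
  have : IsFiniteMeasure η := ⟨by
    rw [← mass_map η measurable_fst, h0, mass_map π (measurable_eval 0)]; exact measure_lt_top _ _⟩
  obtain ⟨x, R, hb⟩ := h.2.1
  have hm : MeasurableSet {y : X | dist y x ≤ R} := isClosed_closedBall.measurableSet
  have ha : ∀ᵐ p ∂η, dist p.1 x ≤ R := by
    rw [← ae_map_iff (p := fun y => dist y x ≤ R) measurable_fst.aemeasurable hm, h0,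
      ← ae_map_eval hm]
    exact hb.mono fun _ h => h.1
  have hb : ∀ᵐ p ∂η, dist p.2 x ≤ R := by
    rw [← ae_map_iff (p := fun y => dist y x ≤ R) measurable_snd.aemeasurable hm, h1,
      ← ae_map_eval hm]
    exact hb.mono fun _ h => h.2
  have key : ∀ δ : ℝ, 0 < δ → transportCost π ≤ (∫⁻ p, ENNReal.ofReal (dist p.1 p.2 ^ 2) ∂η)
      + ENNReal.ofReal (8 * R * δ + 4 * δ ^ 2) * η univ := by
    intro δ hδ
    obtain ⟨P, hP0, hP1, hc⟩ := lift_coupling hE η hδ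
    refine (h.2.2 P (hP0.trans h0) (hP1.trans h1)).trans (hc.trans ?_)
    rw [← lintegral_const, ← lintegral_add_right _ measurable_const]
    refine lintegral_mono_ae ?_
    filter_upwards [ha, hb] with p h1 h2
    have hd : dist p.1 p.2 ≤ 2 * R := (dist_triangle_right _ _ x).trans (by linarith)
    have hR : 0 ≤ R := dist_nonneg.trans h1
    rw [← ENNReal.ofReal_add (by positivity) (by positivity)]
    apply ENNReal.ofReal_le_ofReal
    nlinarith
  have hlim : Filter.Tendsto (fun n : ℕ => (∫⁻ p, ENNReal.ofReal (dist p.1 p.2 ^ 2) ∂η)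
      + ENNReal.ofReal (8 * R * (1 / ((n : ℝ) + 1)) + 4 * (1 / ((n : ℝ) + 1)) ^ 2) * η univ)
      Filter.atTop (nhds ((∫⁻ p, ENNReal.ofReal (dist p.1 p.2 ^ 2) ∂η) +
        ENNReal.ofReal (8 * R * 0 + 4 * 0 ^ 2) * η univ)) := by
    have t := tendsto_one_div_add_atTop_nhds_zero_nat (𝕜 := ℝ)
    refine tendsto_const_nhds.add (ENNReal.Tendsto.mul_const (ENNReal.tendsto_ofReal
      ((t.const_mul _).add ((t.pow 2).const_mul 4))) (Or.inr (measure_ne_top _ _)))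
  have := ge_of_tendsto' hlim fun n => key _ (by positivity)
  simpa using this

open ProbabilityTheory in
theorem glue [StandardBorelSpace X] [Nonempty X] (α β : Measure (X × X)) [IsFiniteMeasure α]
    [IsFiniteMeasure β] (h : α.fst = β.fst) :
    ∃ Q : Measure (X × (X × X)), Q.map (fun p => (p.1, p.2.1)) = α ∧
      Q.map (fun p => (p.1, p.2.2)) = β := by
  refine ⟨α.fst.compProd (α.condKernel ×ₖ β.condKernel), ?_, ?_⟩
  · have := Measure.compProd_map (μ := α.fst) (κ := α.condKernel ×ₖ β.condKernel)
      (measurable_fst : Measurable (Prod.fst : X × X → X))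
    rw [← Kernel.fst_eq, Kernel.fst_prod, Measure.disintegrate] at this
    exact this.symm
  · have := Measure.compProd_map (μ := α.fst) (κ := α.condKernel ×ₖ β.condKernel)
      (measurable_snd : Measurable (Prod.snd : X × X → X))
    rw [← Kernel.snd_eq, Kernel.snd_prod, h, Measure.disintegrate] at this
    rw [h]
    exact this.symm

end Gluing

section RestOpt

variable [BorelSpace X]

theorem convex_ineq {u v b : ℝ} (hb : 0 < b) (hb1 : b < 1) :
    (u + v) ^ 2 ≤ 1 / b * u ^ 2 + 1 / (1 - b) * v ^ 2 := by
  have h1 : 0 < 1 - b := by linarith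
  have : 1 / b * u ^ 2 + 1 / (1 - b) * v ^ 2 - (u + v) ^ 2
      = ((1 - b) * u - b * v) ^ 2 / (b * (1 - b)) := by
    field_simp; ring
  have h2 : 0 ≤ ((1 - b) * u - b * v) ^ 2 / (b * (1 - b)) := by positivity
  linarith

theorem MOpt.rest [StandardBorelSpace X] [TopologicalSpace.SeparableSpace X] [Nonempty X]
    (hE : HasPlans X)
    {π : Measure (Geo X)} (h : MOpt π) (b : unitInterval) (hb : 0 < (b : ℝ)) (hb1 : (b : ℝ) < 1) :
    MOpt (π.map (rest b)) := by
  have hf := h.1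
  have : SecondCountableTopology X := UniformSpace.secondCountable_of_separable X
  refine ⟨inferInstance, ?_, fun π' h0 h1 => ?_⟩
  · obtain ⟨x, R, hx⟩ := bdd_eval h.2.1
    refine ⟨x, R, ?_⟩
    rw [ae_map_iff (measurable_rest b).aemeasurable]
    · filter_upwards [hx (b * 0), hx (b * 1)] with γ h1 h2
      exact ⟨h1, h2⟩
    · exact ((isClosed_le ((continuous_eval 0).dist continuous_const) continuous_const).inter
        (isClosed_le ((continuous_eval 1).dist continuous_const) continuous_const)).measurableSet
  · rw [map_eval_rest] at h0 h1
    rw [mul_zero] at h0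
    rw [mul_one] at h1
    have hf' : IsFiniteMeasure π' := finite_of_eq h0
    have m1 : Measurable (fun γ : Geo X => (eval 1 γ, eval 0 γ)) :=
      (measurable_eval 1).prodMk (measurable_eval 0)
    have m2 : Measurable (fun γ : Geo X => (eval b γ, eval 1 γ)) :=
      (measurable_eval b).prodMk (measurable_eval 1)
    obtain ⟨Q, hQ1, hQ2⟩ := glue (π'.map (fun γ => (eval 1 γ, eval 0 γ)))
      (π.map (fun γ => (eval b γ, eval 1 γ))) (by
        rw [Measure.fst, Measure.fst, Measure.map_map measurable_fst m1,
          Measure.map_map measurable_fst m2]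
        exact h1)
    have k1 : Measurable (fun p : X × (X × X) => (p.1, p.2.1)) := by fun_prop
    have k2 : Measurable (fun p : X × (X × X) => (p.1, p.2.2)) := by fun_prop
    have k3 : Measurable (fun p : X × (X × X) => (p.2.1, p.2.2)) := by fun_prop
    have hdm : Measurable (fun p : X × X => ENNReal.ofReal (dist p.1 p.2 ^ 2)) := by fun_prop
    have hle := h.le_coupling hE (Q.map (fun p => (p.2.1, p.2.2))) (by
        rw [Measure.map_map measurable_fst k3]
        have := congrArg (Measure.map Prod.snd) hQ1
        rw [Measure.map_map measurable_snd k1, Measure.map_map measurable_snd m1] at this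
        exact this.trans h0) (by
        rw [Measure.map_map measurable_snd k3]
        have := congrArg (Measure.map Prod.snd) hQ2
        rw [Measure.map_map measurable_snd k2, Measure.map_map measurable_snd m2] at this
        exact this)
    rw [lintegral_map hdm k3] at hle
    have hb1' : 0 < 1 - (b : ℝ) := by linarith
    have e1 : ∫⁻ p, ENNReal.ofReal (dist p.1 p.2.1 ^ 2) ∂Q = transportCost π' := by
      have := lintegral_map (μ := Q) hdm k1
      rw [hQ1, lintegral_map hdm m1] at this
      rw [← this]
      simp only [transportCost, dist_comm]
    have e2 : ∫⁻ p, ENNReal.ofReal (dist p.1 p.2.2 ^ 2) ∂Q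
        = ENNReal.ofReal ((1 - b) ^ 2) * transportCost π := by
      have := lintegral_map (μ := Q) hdm k2
      rw [hQ2, lintegral_map hdm m2] at this
      rw [← this]
      unfold transportCost
      rw [← lintegral_const_mul _ measurable_cost]
      refine lintegral_congr fun γ => ?_
      simp only
      rw [geo_dist γ b 1, mul_pow, ENNReal.ofReal_mul (by positivity), sq_abs, Set.Icc.coe_one]
      congr 2; ring
    have e3 : transportCost (π.map (_root_.rest b)) = ENNReal.ofReal (b ^ 2) * transportCost π := by
      unfold transportCost
      rw [lintegral_map measurable_cost (measurable_rest b), ← lintegral_const_mul _ measurable_cost]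
      refine lintegral_congr fun γ => ?_
      rw [eval_rest, eval_rest, mul_zero, mul_one, geo_dist γ 0 b, mul_pow,
        ENNReal.ofReal_mul (by positivity), sq_abs, Set.Icc.coe_zero]
      congr 2; ring
    have hle2 : transportCost π ≤ ENNReal.ofReal (1 / b) * transportCost π' +
        ENNReal.ofReal (1 - b) * transportCost π := by
      calc transportCost π ≤ _ := hle
        _ ≤ ∫⁻ p, (ENNReal.ofReal (1 / b) * ENNReal.ofReal (dist p.1 p.2.1 ^ 2) +
              ENNReal.ofReal (1 / (1 - b)) * ENNReal.ofReal (dist p.1 p.2.2 ^ 2)) ∂Q := by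
            refine lintegral_mono fun p => ?_
            simp only
            rw [← ENNReal.ofReal_mul (by positivity), ← ENNReal.ofReal_mul (by positivity),
              ← ENNReal.ofReal_add (by positivity) (by positivity)]
            apply ENNReal.ofReal_le_ofReal
            refine le_trans ?_ (convex_ineq hb hb1)
            have := dist_triangle_left p.2.1 p.2.2 p.1
            gcongr
        _ = ENNReal.ofReal (1 / b) * transportCost π' +
              ENNReal.ofReal (1 / (1 - b)) * (ENNReal.ofReal ((1 - b) ^ 2) * transportCost π) := by
            rw [lintegral_add_left (by fun_prop), lintegral_const_mul _ (by fun_prop),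
              lintegral_const_mul _ (by fun_prop), e1, e2]
        _ = _ := by
            rw [← mul_assoc, ← ENNReal.ofReal_mul (by positivity)]
            congr 3
            field_simp
    have hc := cost_ne_top h.2.1
    have hsplit : transportCost π = ENNReal.ofReal b * transportCost π +
        ENNReal.ofReal (1 - b) * transportCost π := by
      rw [← add_mul, ← ENNReal.ofReal_add hb.le hb1'.le]; simp
    nth_rw 1 [hsplit] at hle2
    have h3 := (ENNReal.add_le_add_iff_right (ENNReal.mul_ne_top ENNReal.ofReal_ne_top hc)).1 hle2
    rw [e3]
    calc ENNReal.ofReal (b ^ 2) * transportCost π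
        = ENNReal.ofReal b * (ENNReal.ofReal b * transportCost π) := by
          rw [← mul_assoc, ← ENNReal.ofReal_mul hb.le, sq]
      _ ≤ ENNReal.ofReal b * (ENNReal.ofReal (1 / b) * transportCost π') := by gcongr
      _ = transportCost π' := by
          rw [← mul_assoc, ← ENNReal.ofReal_mul hb.le, mul_one_div_cancel hb.ne']; simp

/-- Restriction of a geodesic to `[a,1]`. -/
def restR (a : unitInterval) (γ : Geo X) : Geo X := rev (rest (unitInterval.symm a) (rev γ))

theorem measurable_restR (a : unitInterval) : Measurable (restR a : Geo X → Geo X) :=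
  measurable_rev.comp ((measurable_rest _).comp measurable_rev)

theorem map_eval_restR (π : Measure (Geo X)) (a t : unitInterval) :
    (π.map (restR a)).map (eval t) =
      π.map (eval (unitInterval.symm (unitInterval.symm a * unitInterval.symm t))) := by
  rw [Measure.map_map (measurable_eval t) (measurable_restR a)]; rfl

theorem MOpt.restR [StandardBorelSpace X] [TopologicalSpace.SeparableSpace X] [Nonempty X]
    (hE : HasPlans X) {π : Measure (Geo X)} (h : MOpt π) (a : unitInterval) (ha : 0 < (a : ℝ))
    (ha1 : (a : ℝ) < 1) : MOpt (π.map (restR a)) := by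
  have := ((h.rev).rest hE (unitInterval.symm a) (by simpa using ha1) (by simpa using ha)).rev
  rwa [Measure.map_map (measurable_rest _) measurable_rev,
    Measure.map_map measurable_rev ((measurable_rest _).comp measurable_rev)] at this

end RestOpt

section

structure Hyp (m : Measure X) (N : ℝ) : Prop where
  bdd : ∀ s : Set X, Bornology.IsBounded s → m s ≠ ⊤
  hN : 1 ≤ N
  cd : IsCDStar 0 N m
  gt : GoodTransport m

theorem Hyp.plans {m : Measure X} {N : ℝ} (H : Hyp m N) : HasPlans X := by
  intro μ₀ μ₁ h0 h1 hs
  obtain ⟨π, h, _⟩ := H.cd μ₀ μ₁ h0 h1 hs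
  exact ⟨π, h⟩

variable [BorelSpace X]

theorem sigma_zero {N' s θ : ℝ} (h : 0 < N') : sigmaCoeff 0 N' s θ = ENNReal.ofReal s := by
  unfold sigmaCoeff
  have : ¬ (N' * Real.pi ^ 2 ≤ 0) := by
    have := Real.pi_pos
    rw [not_le]; positivity
  simp [this]

theorem second_moment_of_bdd {π : Measure (Geo X)} [IsFiniteMeasure π] {x : X} {R : ℝ}
    {t : unitInterval} (h : ∀ᵐ γ ∂π, dist (eval t γ) x ≤ R) :
    HasFiniteSecondMoment (π.map (eval t)) := by
  refine ⟨x, ?_⟩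
  rw [lintegral_map (by fun_prop) (measurable_eval t)]
  have : ∫⁻ γ, ENNReal.ofReal (dist (eval t γ) x ^ 2) ∂π ≤ ∫⁻ _, ENNReal.ofReal (R ^ 2) ∂π := by
    refine lintegral_mono_ae (h.mono fun γ hγ => ?_)
    gcongr
  refine ne_top_of_le_ne_top ?_ this
  rw [lintegral_const]
  exact ENNReal.mul_ne_top ENNReal.ofReal_ne_top (measure_ne_top _ _)

variable {m : Measure X} [SigmaFinite m] {N : ℝ}

theorem cd_raw (H : Hyp m N) {π : Measure (Geo X)} (h : MOpt π) (hac : π.map (eval 0) ≪ m) :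
    ∃ π' : Measure (Geo X), MOpt π' ∧ π'.map (eval 0) = π.map (eval 0) ∧
      π'.map (eval 1) = π.map (eval 1) ∧
      (∀ (t : unitInterval) (N' : ℝ), N ≤ N' → 1 < N' →
        ENNReal.ofReal (1 - (t : ℝ)) * FF m (1 - 1 / N') (π.map (eval 0)) ≤
          FF m (1 - 1 / N') (π'.map (eval t))) ∧
      (π.map (eval 1) ≪ m → π' = π ∧ ∀ (t : unitInterval) (N' : ℝ), N ≤ N' → 1 < N' →
        ENNReal.ofReal (1 - (t : ℝ)) * FF m (1 - 1 / N') (π.map (eval 0)) +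
          ENNReal.ofReal (t : ℝ) * FF m (1 - 1 / N') (π.map (eval 1)) ≤
          FF m (1 - 1 / N') (π.map (eval t))) := by
  have hf := h.1
  by_cases hz : π = 0
  · subst hz
    have hq : ∀ N' : ℝ, 1 < N' → 0 < 1 - 1 / N' := fun N' hN' => by
      have : 1 / N' < 1 := by rw [div_lt_one (by linarith)]; exact hN'
      linarith
    have e : ∀ N' : ℝ, 1 < N' → FF m (1 - 1 / N') (0 : Measure X) = 0 := fun N' hN' => by
      have := FF_le m (hq N' hN') (by simp; linarith) (0 : Measure X) MeasurableSet.empty (by simp)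
      rw [Measure.coe_zero, Pi.zero_apply, ENNReal.zero_rpow_of_pos (hq N' hN'), zero_mul] at this
      exact le_antisymm this bot_le
    refine ⟨0, h, rfl, rfl, fun t N' h1 h2 => by simp only [Measure.map_zero, e N' h2, mul_zero, add_zero, le_refl], fun _ => ⟨rfl, fun t N' h1 h2 => by
      simp only [Measure.map_zero, e N' h2, mul_zero, add_zero, le_refl]⟩⟩
  have hne : π univ ≠ 0 := by simpa using hz
  have hnt : π univ ≠ ⊤ := measure_ne_top _ _
  set w := π univ with hw
  have hwi : w⁻¹ ≠ ⊤ := ENNReal.inv_ne_top.2 hne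
  have hO := h.isOptGeo hz
  rw [← hw] at hO
  have hP1 := hO.1
  obtain ⟨x, R, hb⟩ := h.2.1
  have hb0 : ∀ᵐ γ ∂(w⁻¹ • π), dist (eval 0 γ) x ≤ R :=
    (Measure.smul_absolutelyContinuous) (hb.mono fun γ h => h.1)
  have hb1 : ∀ᵐ γ ∂(w⁻¹ • π), dist (eval 1 γ) x ≤ R :=
    (Measure.smul_absolutelyContinuous) (hb.mono fun γ h => h.2)
  have hcm : MeasurableSet {y : X | dist y x ≤ R} := isClosed_closedBall.measurableSet
  have p0 : IsProbabilityMeasure ((w⁻¹ • π).map (eval 0)) :=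
    Measure.isProbabilityMeasure_map (measurable_eval 0).aemeasurable
  have p1 : IsProbabilityMeasure ((w⁻¹ • π).map (eval 1)) :=
    Measure.isProbabilityMeasure_map (measurable_eval 1).aemeasurable
  obtain ⟨P, hPO, hP⟩ := H.cd _ _ p0 p1 ⟨closedBall x R, isBounded_closedBall,
    by exact (ae_map_eval (p := fun y => dist y x ≤ R) hcm).1 hb0,
    by exact (ae_map_eval (p := fun y => dist y x ≤ R) hcm).1 hb1⟩
  have hPp := hPO.1
  have hmap : ∀ t, (w • P).map (eval t) = w • P.map (eval t) := fun t => Measure.map_smul _ _ _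
  have hmapπ : ∀ t, (w⁻¹ • π).map (eval t) = w⁻¹ • π.map (eval t) := fun t => Measure.map_smul _ _ _
  have hback : ∀ μ : Measure X, w • (w⁻¹ • μ) = μ := fun μ => by
    rw [smul_smul, ENNReal.mul_inv_cancel hne hnt, one_smul]
  have hback2 : w • (w⁻¹ • π) = π := by
    rw [smul_smul, ENNReal.mul_inv_cancel hne hnt, one_smul]
  have m0 : (w • P).map (eval 0) = π.map (eval 0) := by rw [hmap, hPO.2.1, hmapπ, hback]
  have m1 : (w • P).map (eval 1) = π.map (eval 1) := by rw [hmap, hPO.2.2.1, hmapπ, hback]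
  have hcost : transportCost (w • P) ≤ transportCost π := by
    have := hPO.2.2.2 (w⁻¹ • π) hP1 rfl rfl
    conv_rhs => rw [← hback2]
    rw [cost_smul, cost_smul w]
    gcongr
  have hmo : MOpt (w • P) := h.of_cost m0 m1 hcost
  have pf0 : P.map (eval 0) ≪ m := by
    rw [hPO.2.1, hmapπ]; exact Measure.smul_absolutelyContinuous.trans hac
  have pre : ∀ (t : unitInterval) (N' : ℝ), N ≤ N' → 1 < N' →
      ENNReal.ofReal (1 - (t : ℝ)) * FF m (1 - 1 / N') (P.map (eval 0)) +
        ENNReal.ofReal (t : ℝ) * ∫⁻ y, ((P.map (eval 1)).rnDeriv m y) ^ (-(1 / N')) ∂(P.map (eval 1))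
        ≤ FF m (1 - 1 / N') (P.map (eval t)) := by
    intro t N' h1 h2
    have hN0 : 0 < N' := by linarith
    have hq : 1 / N' < 1 := by rw [div_lt_one hN0]; exact h2
    have := hP t N' h1
    simp only [sigma_zero hN0] at this
    have ms : ∀ i, Measurable fun γ : Geo X => ((P.map (eval i)).rnDeriv m (eval i γ)) ^ (-(1 / N')) :=
      fun i => ((Measure.measurable_rnDeriv _ _).pow_const _).comp (measurable_eval i)
    rw [lintegral_add_left ((ms 0).const_mul _), lintegral_const_mul _ (ms 0),
      lintegral_const_mul _ (ms 1)] at this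
    rw [← FF_eq m (1 / N') hq _ pf0, lintegral_map ((Measure.measurable_rnDeriv _ _).pow_const _)
      (measurable_eval 0), lintegral_map ((Measure.measurable_rnDeriv _ _).pow_const _)
      (measurable_eval 1)]
    exact this
  have hsm : ∀ (t : unitInterval) (N' : ℝ), 1 < N' → FF m (1 - 1 / N') ((w • P).map (eval t))
      = w ^ (1 - 1 / N') * FF m (1 - 1 / N') (P.map (eval t)) := fun t N' h2 => by
    have : 1 / N' < 1 := by rw [div_lt_one (by linarith)]; exact h2
    rw [hmap, FF_smul m (by linarith) _ hnt]
  refine ⟨w • P, hmo, m0, m1, fun t N' h1 h2 => ?_, fun hac1 => ?_⟩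
  · rw [← m0, hsm _ _ h2, hsm _ _ h2, mul_left_comm]
    gcongr
    exact le_self_add.trans (pre t N' h1 h2)
  · have heq : P = w⁻¹ • π := by
      refine (H.gt _ _ p0 p1 (second_moment_of_bdd hb0) (second_moment_of_bdd hb1) ?_ ?_).1.unique
        hPO hO
      · rw [← hPO.2.1]; exact pf0
      · rw [hmapπ]; exact Measure.smul_absolutelyContinuous.trans hac1
    have heq' : w • P = π := by rw [heq, hback2]
    refine ⟨heq', fun t N' h1 h2 => ?_⟩
    rw [← heq', hsm _ _ h2, hsm _ _ h2, hsm _ _ h2, mul_left_comm, mul_left_comm _ (w ^ _), ← mul_add]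
    gcongr
    have hq : 1 / N' < 1 := by rw [div_lt_one (by linarith)]; exact h2
    have pf1 : P.map (eval 1) ≪ m := by
      rw [hPO.2.2.1, hmapπ]; exact Measure.smul_absolutelyContinuous.trans hac1
    have := pre t N' h1 h2
    rwa [FF_eq m (1 / N') hq _ pf1] at this

theorem cd_two (H : Hyp m N) {π : Measure (Geo X)} (h : MOpt π) (h0 : π.map (eval 0) ≪ m)
    (h1 : π.map (eval 1) ≪ m) (t : unitInterval) {N' : ℝ} (hN' : N ≤ N') (hN1 : 1 < N') :
    ENNReal.ofReal (1 - (t : ℝ)) * FF m (1 - 1 / N') (π.map (eval 0)) +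
      ENNReal.ofReal (t : ℝ) * FF m (1 - 1 / N') (π.map (eval 1)) ≤
      FF m (1 - 1 / N') (π.map (eval t)) := by
  obtain ⟨_, _, _, _, _, h⟩ := cd_raw H h h0
  exact (h h1).2 t N' hN' hN1

theorem bdd_set (H : Hyp m N) {π : Measure (Geo X)} (h : BddPlan π) :
    ∃ s : Set X, MeasurableSet s ∧ m s ≠ ⊤ ∧ ∀ t, π.map (eval t) sᶜ = 0 := by
  obtain ⟨x, R, h⟩ := bdd_eval h
  refine ⟨closedBall x R, isClosed_closedBall.measurableSet, H.bdd _ isBounded_closedBall, fun t => ?_⟩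
  exact (ae_map_eval (p := fun y => y ∈ closedBall x R) isClosed_closedBall.measurableSet).1 (h t)

theorem ev_N (N : ℝ) : ∀ᶠ n : ℕ in Filter.atTop, N ≤ (n : ℝ) + 2 := by
  filter_upwards [Filter.eventually_ge_atTop ⌈N⌉₊] with n hn
  have := Nat.ceil_le.1 hn
  linarith

theorem mass_ac {μ : Measure X} [IsFiniteMeasure μ] (h : μ ≪ m) :
    ∫⁻ x, μ.rnDeriv m x ∂m = μ univ := Measure.lintegral_rnDeriv h

theorem cd_ac_time (H : Hyp m N) {π : Measure (Geo X)} (h : MOpt π) (h0 : π.map (eval 0) ≪ m)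
    (h1 : π.map (eval 1) ≪ m) (t : unitInterval) : π.map (eval t) ≪ m := by
  have hf := h.1
  obtain ⟨s, hs, hms, hsc⟩ := bdd_set H h.2.1
  have A := fun t => FF_tendsto m (π.map (eval t)) hs hms (hsc t)
  refine ac_of_mass m _ ?_
  have L := (ENNReal.Tendsto.const_mul (a := ENNReal.ofReal (1 - (t : ℝ))) (A 0)
    (Or.inr ENNReal.ofReal_ne_top)).add
    (ENNReal.Tendsto.const_mul (a := ENNReal.ofReal (t : ℝ)) (A 1) (Or.inr ENNReal.ofReal_ne_top))
  have := le_of_tendsto_of_tendsto L (A t) (by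
    filter_upwards [ev_N N] with n hn
    exact cd_two H h h0 h1 t hn (by linarith [(Nat.cast_nonneg n : (0 : ℝ) ≤ n)]))
  rw [mass_ac h0, mass_ac h1, mass_map _ (measurable_eval _), mass_map _ (measurable_eval _),
    ← add_mul, ← ENNReal.ofReal_add (by linarith [t.2.2]) t.2.1] at this
  rw [mass_map _ (measurable_eval _)]
  simpa using this

theorem cd_mass_time (H : Hyp m N) {π : Measure (Geo X)} (h : MOpt π) (h0 : π.map (eval 0) ≪ m) :
    ∃ π' : Measure (Geo X), MOpt π' ∧ π'.map (eval 0) = π.map (eval 0) ∧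
      π'.map (eval 1) = π.map (eval 1) ∧
      ∀ t : unitInterval, ENNReal.ofReal (1 - (t : ℝ)) * π univ ≤
        ∫⁻ x, (π'.map (eval t)).rnDeriv m x ∂m := by
  have hf := h.1
  obtain ⟨π', a, b, c, d, _⟩ := cd_raw H h h0
  have hf' := a.1
  refine ⟨π', a, b, c, fun t => ?_⟩
  obtain ⟨s, hs, hms, hsc⟩ := bdd_set H a.2.1
  have A := fun t => FF_tendsto m (π'.map (eval t)) hs hms (hsc t)
  have := le_of_tendsto_of_tendsto (ENNReal.Tendsto.const_mul (a := ENNReal.ofReal (1 - (t : ℝ))) (A 0)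
    (Or.inr ENNReal.ofReal_ne_top)) (A t) (by
    filter_upwards [ev_N N] with n hn
    rw [b]
    exact d t _ hn (by linarith [(Nat.cast_nonneg n : (0 : ℝ) ≤ n)]))
  rwa [b, mass_ac h0, mass_map _ (measurable_eval _)] at this

end

section
variable [BorelSpace X] [StandardBorelSpace X] [TopologicalSpace.SeparableSpace X] [Nonempty X]
variable {m : Measure X} [SigmaFinite m] {N : ℝ}

theorem cd_left (H : Hyp m N) {π : Measure (Geo X)} (h : MOpt π) (h0 : π.map (eval 0) ≪ m)
    (h1 : π.map (eval 1) ≪ m) {t s : unitInterval} (ht : 0 < (t : ℝ)) (hts : (t : ℝ) < s)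
    (hs : (s : ℝ) < 1) {N' : ℝ} (hN' : N ≤ N') (hN1 : 1 < N') :
    ENNReal.ofReal ((t : ℝ) / s) * FF m (1 - 1 / N') (π.map (eval s)) ≤
      FF m (1 - 1 / N') (π.map (eval t)) := by
  have hs0 : 0 < (s : ℝ) := ht.trans hts
  have hr := h.rest H.plans s hs0 hs
  let r : unitInterval := ⟨(t : ℝ) / s, by positivity, by rw [div_le_one hs0]; exact hts.le⟩
  have e0 : (π.map (rest s)).map (eval 0) = π.map (eval 0) := by rw [map_eval_rest, mul_zero]
  have e1 : (π.map (rest s)).map (eval 1) = π.map (eval s) := by rw [map_eval_rest, mul_one]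
  have er : (π.map (rest s)).map (eval r) = π.map (eval t) := by
    rw [map_eval_rest]; congr 2
    apply Subtype.ext
    show (s : ℝ) * (t / s) = t
    field_simp
  have := cd_two H hr (by rw [e0]; exact h0) (by rw [e1]; exact cd_ac_time H h h0 h1 s) r hN' hN1
  rw [er, e1] at this
  exact le_add_self.trans this

theorem cd_right (H : Hyp m N) {π : Measure (Geo X)} (h : MOpt π) (h0 : π.map (eval 0) ≪ m)
    (h1 : π.map (eval 1) ≪ m) {t s : unitInterval} (ht : 0 < (t : ℝ)) (hts : (t : ℝ) < s)
    (hs : (s : ℝ) < 1) {N' : ℝ} (hN' : N ≤ N') (hN1 : 1 < N') :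
    ENNReal.ofReal ((1 - (s : ℝ)) / (1 - t)) * FF m (1 - 1 / N') (π.map (eval t)) ≤
      FF m (1 - 1 / N') (π.map (eval s)) := by
  have hr := h.restR H.plans t ht (hts.trans hs)
  have ht1 : 0 < 1 - (t : ℝ) := by linarith
  have hs1 : 0 < 1 - (s : ℝ) := by linarith
  have hq : (1 - (s : ℝ)) / (1 - t) ≤ 1 := by rw [div_le_one ht1]; linarith
  let r : unitInterval := ⟨1 - (1 - (s : ℝ)) / (1 - t), by linarith,
    by have : 0 < (1 - (s : ℝ)) / (1 - t) := by positivity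
       linarith⟩
  have e0 : (π.map (restR t)).map (eval 0) = π.map (eval t) := by
    rw [map_eval_restR]; congr 2; simp
  have e1 : (π.map (restR t)).map (eval 1) = π.map (eval 1) := by
    rw [map_eval_restR]; congr 2; simp
  have er : (π.map (restR t)).map (eval r) = π.map (eval s) := by
    rw [map_eval_restR]; congr 2
    apply Subtype.ext
    show 1 - (1 - (t : ℝ)) * (1 - (1 - (1 - (s : ℝ)) / (1 - t))) = s
    field_simp; ring
  have := cd_two H hr (by rw [e0]; exact cd_ac_time H h h0 h1 t) (by rw [e1]; exact h1) r hN' hN1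
  rw [er, e0] at this
  have hrr : 1 - (r : ℝ) = (1 - (s : ℝ)) / (1 - t) := by
    show 1 - (1 - (1 - (s : ℝ)) / (1 - t)) = _
    ring
  rw [hrr] at this
  exact le_self_add.trans this

theorem mapmono {a b : Measure (Geo X)} (h : a ≤ b) (t : unitInterval) :
    a.map (eval t) ≤ b.map (eval t) := Measure.map_mono h (measurable_eval t)

theorem map_ac {a b : Measure (Geo X)} (h : a ≤ b) {t : unitInterval} (hb : b.map (eval t) ≪ m) :
    a.map (eval t) ≪ m := (Measure.absolutelyContinuous_of_le (mapmono h t)).trans hb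

theorem FF_fin (H : Hyp m N) {π : Measure (Geo X)} (h : MOpt π) {p : ℝ} (hp : 0 < p) (hp1 : p < 1)
    (t : unitInterval) : FF m p (π.map (eval t)) ≠ ⊤ := by
  have hf := h.1
  obtain ⟨s, hs, hms, hsc⟩ := bdd_set H h.2.1
  refine ne_top_of_le_ne_top ?_ (FF_le m hp hp1 _ hs (hsc t))
  exact ENNReal.mul_ne_top (ENNReal.rpow_ne_top_of_nonneg hp.le (measure_ne_top _ _))
    (ENNReal.rpow_ne_top_of_nonneg (by linarith) hms)

theorem sing_small (H : Hyp m N) {π₁ π₂ : Measure (Geo X)} (h : MOpt (π₁ + π₂))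
    (h0 : (π₁ + π₂).map (eval 0) ≪ m) (h1 : (π₁ + π₂).map (eval 1) ≪ m)
    {t s : unitInterval} (ht : 0 < (t : ℝ)) (hts : (t : ℝ) < s) (hs : (s : ℝ) < 1)
    (hk : (2 : ℝ) ^ (1 - 1 / (N + 1)) < 2 * ((t : ℝ) / s * ((1 - s) / (1 - t))))
    (hsing : π₁.map (eval s) ⟂ₘ π₂.map (eval s)) : π₁.map (eval t) ⟂ₘ π₂.map (eval t) := by
  by_contra hcon
  have hf := h.1
  have := (h.sub (Measure.le_add_right le_rfl : π₁ ≤ π₁ + π₂)).1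
  have := (h.sub (Measure.le_add_left le_rfl : π₂ ≤ π₁ + π₂)).1
  obtain ⟨α, hα, β, hβ, hab, hne⟩ := common_sub (measurable_eval t) π₁ π₂ hcon
  have lα : α ≤ π₁ + π₂ := hα.trans (Measure.le_add_right le_rfl)
  have lβ : β ≤ π₁ + π₂ := hβ.trans (Measure.le_add_left le_rfl)
  have lab : α + β ≤ π₁ + π₂ := add_le_add hα hβ
  have oα := h.sub lα
  have oβ := h.sub lβ
  have oab := h.sub lab
  have := oα.1
  have := oβ.1
  have hN' : N ≤ N + 1 := by linarith
  have hN1 : 1 < N + 1 := by linarith [H.hN]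
  have hq0 : 0 < 1 / (N + 1) := by have := H.hN; positivity
  have hq1 : 1 / (N + 1) < 1 := by rw [div_lt_one (by linarith)]; exact hN1
  set p := 1 - 1 / (N + 1) with hp
  have hp0 : 0 < p := by linarith
  have hp1 : p < 1 := by linarith
  have I1 := cd_left H oab (map_ac lab h0) (map_ac lab h1) ht hts hs hN' hN1
  have I2 := cd_right H oα (map_ac lα h0) (map_ac lα h1) ht hts hs hN' hN1
  have I3 := cd_right H oβ (map_ac lβ h0) (map_ac lβ h1) ht hts hs hN' hN1
  rw [← hp] at I1 I2 I3
  have hsing' : α.map (eval s) ⟂ₘ β.map (eval s) :=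
    hsing.mono (mapmono hα s) (mapmono hβ s)
  rw [Measure.map_add _ _ (measurable_eval _), Measure.map_add _ _ (measurable_eval _),
    FF_add m hp0 _ _ hsing', ← hab, ← two_smul ℝ≥0∞, FF_smul m hp0.le _ (by simp)] at I1
  rw [← hab] at I3
  set F := FF m p (α.map (eval t)) with hF
  have hF0 : F ≠ 0 := FF_ne_zero m hp0 _ (cd_ac_time H oα (map_ac lα h0) (map_ac lα h1) t) hne
  have hFt : F ≠ ⊤ := FF_fin H oα hp0 hp1 t
  have I4 : ENNReal.ofReal ((t : ℝ) / s) * (ENNReal.ofReal ((1 - (s : ℝ)) / (1 - t)) * F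
      + ENNReal.ofReal ((1 - (s : ℝ)) / (1 - t)) * F) ≤ 2 ^ p * F :=
    (mul_le_mul_right (add_le_add I2 I3) _).trans I1
  have hs0 : 0 < (s : ℝ) := ht.trans hts
  have e : ENNReal.ofReal ((t : ℝ) / s) * (ENNReal.ofReal ((1 - (s : ℝ)) / (1 - t)) * F
      + ENNReal.ofReal ((1 - (s : ℝ)) / (1 - t)) * F)
      = ENNReal.ofReal (2 * ((t : ℝ) / s * ((1 - s) / (1 - t)))) * F := by
    rw [ENNReal.ofReal_mul (by norm_num), ENNReal.ofReal_mul (by positivity), ENNReal.ofReal_ofNat]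
    ring
  have e2 : (2 : ℝ≥0∞) ^ p = ENNReal.ofReal ((2 : ℝ) ^ p) := by
    rw [← ENNReal.ofReal_rpow_of_pos (by norm_num), ENNReal.ofReal_ofNat]
  rw [e, e2, ENNReal.mul_le_mul_iff_left hF0 hFt, ENNReal.ofReal_le_ofReal_iff (by positivity)] at I4
  linarith

theorem sing_prop (H : Hyp m N) {π₁ π₂ : Measure (Geo X)} (h : MOpt (π₁ + π₂))
    (h0 : (π₁ + π₂).map (eval 0) ≪ m) (h1 : (π₁ + π₂).map (eval 1) ≪ m)
    {t s : unitInterval} (ht : 0 < (t : ℝ)) (hts : (t : ℝ) < s) (hs : (s : ℝ) < 1)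
    (hsing : π₁.map (eval s) ⟂ₘ π₂.map (eval s)) : π₁.map (eval t) ⟂ₘ π₂.map (eval t) := by
  set K : ℝ := (2 : ℝ) ^ (1 - 1 / (N + 1)) / 2 with hK
  have hK0 : 0 < K := by positivity
  have hK1 : K < 1 := by
    rw [hK, div_lt_one (by norm_num)]
    have : (2 : ℝ) ^ (1 - 1 / (N + 1)) < (2 : ℝ) ^ (1 : ℝ) := by
      apply Real.rpow_lt_rpow_of_exponent_lt (by norm_num)
      have : 0 < 1 / (N + 1) := by have := H.hN; positivity
      linarith
    simpa using this
  obtain ⟨k, hk, hk1⟩ := exists_between hK1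
  have hk0 : 0 < k := hK0.trans hk
  let g : ℝ → ℝ := fun u => u / (1 - u)
  have step : ∀ t s : unitInterval, 0 < (t : ℝ) → (t : ℝ) < s → (s : ℝ) < 1 →
      k * g s ≤ g t → π₁.map (eval s) ⟂ₘ π₂.map (eval s) → π₁.map (eval t) ⟂ₘ π₂.map (eval t) := by
    intro t s ht hts hs hg hsi
    refine sing_small H h h0 h1 ht hts hs ?_ hsi
    have hs0 : 0 < (s : ℝ) := ht.trans hts
    have hs1 : 0 < 1 - (s : ℝ) := by linarith
    have ht1 : 0 < 1 - (t : ℝ) := by linarith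
    have : k ≤ (t : ℝ) / s * ((1 - s) / (1 - t)) := by
      have e : (t : ℝ) / s * ((1 - s) / (1 - t)) = g t / g s := by
        simp only [g]; field_simp
      rw [e, le_div_iff₀ (by simp only [g]; positivity)]
      exact hg
    rw [hK, div_lt_iff₀ (by norm_num)] at hk
    linarith
  have main : ∀ n : ℕ, ∀ t s : unitInterval, 0 < (t : ℝ) → (t : ℝ) < s → (s : ℝ) < 1 →
      k ^ n * g s ≤ g t → π₁.map (eval s) ⟂ₘ π₂.map (eval s) →
      π₁.map (eval t) ⟂ₘ π₂.map (eval t) := by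
    intro n
    induction n with
    | zero =>
      intro t s ht hts hs hg hsi
      refine step t s ht hts hs (le_trans ?_ hg) hsi
      have hs0 : 0 < (s : ℝ) := ht.trans hts
      have hs1 : 0 < 1 - (s : ℝ) := by linarith
      have : 0 < g s := by simp only [g]; positivity
      rw [pow_zero]; gcongr
    | succ n ih =>
      intro t s ht hts hs hg hsi
      by_cases hc : k * g s ≤ g t
      · exact step t s ht hts hs hc hsi
      rw [not_le] at hc
      have hs0 : 0 < (s : ℝ) := ht.trans hts
      have hs1 : 0 < 1 - (s : ℝ) := by linarith
      have ht1 : 0 < 1 - (t : ℝ) := by linarith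
      have hgs : 0 < g s := by simp only [g]; positivity
      have hx : 0 < k * g s := by positivity
      set x := k * g s with hxd
      let u : unitInterval := ⟨x / (1 + x), by positivity, by rw [div_le_one (by positivity)]; linarith⟩
      have hu : (u : ℝ) = x / (1 + x) := rfl
      have hu1 : 1 - (u : ℝ) = 1 / (1 + x) := by rw [hu]; field_simp; ring
      have hgu : g u = x := by simp only [g]; rw [hu1, hu]; field_simp
      have hu0 : 0 < (u : ℝ) := by rw [hu]; positivity
      have hul : (u : ℝ) < 1 := by rw [hu, div_lt_one (by positivity)]; linarith
      have mono : ∀ a b : ℝ, a < 1 → b < 1 → g a < g b → a < b := by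
        intro a b ha hb hab
        simp only [g] at hab
        rw [div_lt_div_iff₀ (by linarith) (by linarith)] at hab
        nlinarith
      have htu : (t : ℝ) < u := mono _ _ (by linarith) hul (by rw [hgu]; exact hc)
      have hus : (u : ℝ) < s := mono _ _ hul hs (by rw [hgu, hxd]; nlinarith)
      refine ih t u ht htu hul ?_ (step u s hu0 hus hs (by rw [hgu]) hsi)
      rw [hgu, hxd, ← mul_assoc, ← pow_succ]; exact hg
  have hs0 : 0 < (s : ℝ) := ht.trans hts
  have hs1 : 0 < 1 - (s : ℝ) := by linarith
  have ht1 : 0 < 1 - (t : ℝ) := by linarith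
  have hgs : 0 < g s := by simp only [g]; positivity
  have hgt : 0 < g t := by simp only [g]; positivity
  obtain ⟨n, hn⟩ := exists_pow_lt_of_lt_one (div_pos hgt hgs) hk1
  refine main n t s ht hts hs ?_ hsing
  rw [lt_div_iff₀ hgs] at hn
  exact hn.le

end

section
variable [BorelSpace X] [StandardBorelSpace X] [TopologicalSpace.SeparableSpace X] [Nonempty X]
variable {m : Measure X} [SigmaFinite m] {N : ℝ}

theorem exists_level (ν : Measure X) [IsFiniteMeasure ν] (hac : ν ≪ m) (h0 : ν ≠ 0) {x : X} {R : ℝ}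
    (hb : ν (closedBall x R)ᶜ = 0) :
    ∃ (E : Set X) (c : ℝ≥0∞), IsClosed E ∧ Bornology.IsBounded E ∧ c ≠ 0 ∧ c ≠ ⊤ ∧ m E ≠ 0 ∧
      c • m.restrict E ≤ ν := by
  have hm : Measurable (ν.rnDeriv m) := Measure.measurable_rnDeriv _ _
  let A : ℕ → Set X := fun n => {y | ((n : ℝ≥0∞) + 1)⁻¹ ≤ ν.rnDeriv m y}
  have hA : ∀ n, MeasurableSet (A n) := fun n => measurableSet_le measurable_const hm
  have hex : ∃ n, ν (A n) ≠ 0 := by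
    by_contra hcon
    push Not at hcon
    have h1 : ν (⋃ n, A n) = 0 := measure_iUnion_null hcon
    have h2 : ∀ᵐ y ∂ν, 0 < ν.rnDeriv m y := Measure.rnDeriv_pos hac
    have h3 : ν (⋃ n, A n)ᶜ = 0 := by
      refine measure_mono_null ?_ h2
      intro y hy hpos
      apply hy
      obtain ⟨n, hn⟩ := ENNReal.exists_inv_nat_lt (ne_of_gt hpos)
      refine mem_iUnion.2 ⟨n, ?_⟩
      refine le_trans ?_ hn.le
      exact ENNReal.inv_le_inv.2 le_self_add
    apply h0
    rw [← Measure.measure_univ_eq_zero, ← union_compl_self (⋃ n, A n)]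
    exact le_antisymm ((measure_union_le _ _).trans (by rw [h1, h3]; simp)) bot_le
  obtain ⟨n, hn⟩ := hex
  obtain ⟨K, hKA, hK, hKp⟩ := (hA n).exists_lt_isClosed_of_ne_top (measure_ne_top ν _)
    (pos_iff_ne_zero.2 hn)
  refine ⟨K ∩ closedBall x R, ((n : ℝ≥0∞) + 1)⁻¹, hK.inter isClosed_closedBall,
    isBounded_closedBall.subset inter_subset_right, by simp, by simp, ?_, ?_⟩
  · intro hz
    have := hac hz
    have h4 : ν K ≤ ν (K ∩ closedBall x R) + ν (closedBall x R)ᶜ := by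
      refine (measure_mono ?_).trans (measure_union_le _ _)
      intro y hy
      by_cases hyb : y ∈ closedBall x R
      · exact Or.inl ⟨hy, hyb⟩
      · exact Or.inr hyb
    rw [this, hb] at h4
    simp at h4
    exact hKp.ne' h4
  · have hE : MeasurableSet (K ∩ closedBall x R) := (hK.inter isClosed_closedBall).measurableSet
    conv_rhs => rw [← Measure.withDensity_rnDeriv_eq ν m hac]
    rw [← withDensity_const, ← withDensity_indicator hE]
    refine withDensity_mono (Filter.Eventually.of_forall fun y => ?_)
    by_cases hy : y ∈ K ∩ closedBall x R
    · rw [indicator_of_mem hy]; exact hKA hy.1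
    · rw [indicator_of_notMem hy]; exact bot_le

theorem FF_restrict {E : Set X} (hE : MeasurableSet E) {p : ℝ} (hp : 0 < p) :
    FF m p (m.restrict E) = m E := by
  unfold FF
  rw [lintegral_congr_ae (g := E.indicator 1), lintegral_indicator_one hE]
  filter_upwards [Measure.rnDeriv_restrict_self m hE] with x hx
  rw [hx]
  by_cases h : x ∈ E
  · simp [h]
  · simp [h, hp]

theorem ae_transfer {a b : Measure (Geo X)} {t : unitInterval} (h : a.map (eval t) ≤ b.map (eval t))
    {p : X → Prop} (hp : MeasurableSet {x | p x}) (hb : ∀ᵐ γ ∂b, p (eval t γ)) :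
    ∀ᵐ γ ∂a, p (eval t γ) := by
  rw [ae_map_eval hp] at hb ⊢
  exact Measure.absolutelyContinuous_of_le h hb

theorem core_sep (H : Hyp m N) {α β : Measure (Geo X)} (h : MOpt (α + β))
    (he : α.map (eval 0) = β.map (eval 0)) (h0 : (α + β).map (eval 0) ≪ m)
    (h1 : (α + β).map (eval 1) ≪ m) {s : unitInterval} (hs0 : 0 < (s : ℝ)) (hs1 : (s : ℝ) < 1)
    (hsing : α.map (eval s) ⟂ₘ β.map (eval s)) : α = 0 := by
  by_contra hne
  have := h.1
  have lα : α ≤ α + β := Measure.le_add_right le_rfl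
  have lβ : β ≤ α + β := Measure.le_add_left le_rfl
  have fα := (h.sub lα).1
  have fβ := (h.sub lβ).1
  obtain ⟨x, R, hb⟩ := (h.sub lα).2.1
  obtain ⟨E, c, hEc, hEb, hc0, hct, hmE, hle⟩ := exists_level (m := m) (α.map (eval 0)) (map_ac lα h0)
    (fun hz => hne (zero_of_map (measurable_eval 0) hz)) (x := x) (R := R)
    ((ae_map_eval (p := fun y => y ∈ closedBall x R) isClosed_closedBall.measurableSet).1
      (hb.mono fun γ h => h.1))
  obtain ⟨a, ha, hae⟩ := lift_sub (measurable_eval 0) α _ hle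
  obtain ⟨b, hb', hbe⟩ := lift_sub (measurable_eval 0) β _ (he ▸ hle)
  have la : a ≤ α + β := ha.trans lα
  have lb : b ≤ α + β := hb'.trans lβ
  have lab : a + b ≤ α + β := add_le_add ha hb'
  have oa := h.sub la
  have ob := h.sub lb
  have oab := h.sub lab
  have fa := oa.1
  have fb := ob.1
  have fab := oab.1
  obtain ⟨L, hL, hLd⟩ := bdd_dist oab.2.1
  have hmEt : m E ≠ ⊤ := H.bdd E hEb
  have hN' : N ≤ N + 1 := by linarith
  have hN1 : 1 < N + 1 := by linarith [H.hN]
  have hq0 : 0 < 1 / (N + 1) := by have := H.hN; positivity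
  have hq1 : 1 / (N + 1) < 1 := by rw [div_lt_one (by linarith)]; exact hN1
  set p := 1 - 1 / (N + 1) with hp
  have hp0 : 0 < p := by linarith
  have hp1 : p < 1 := by linarith
  have hFF : FF m p (c • m.restrict E) = c ^ p * m E := by
    have : IsFiniteMeasure (m.restrict E) := ⟨by rw [Measure.restrict_apply_univ]; exact hmEt.lt_top⟩
    rw [FF_smul m hp0.le _ hct, FF_restrict hEc.measurableSet hp0]
  have hE0 : ∀ᵐ γ ∂(a + b), eval 0 γ ∈ E := by
    have hn : (c • m.restrict E) Eᶜ = 0 := by simp [Measure.restrict_apply hEc.measurableSet.compl]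
    rw [ae_map_eval (p := fun y => y ∈ E) hEc.measurableSet, Measure.map_add _ _ (measurable_eval 0),
      hae, hbe]
    show (c • m.restrict E + c • m.restrict E) Eᶜ = 0
    rw [Measure.add_apply, hn, add_zero]
  have hmass : (a + b) univ = 2 * (c * m E) := by
    rw [← mass_map _ (measurable_eval 0), Measure.map_add _ _ (measurable_eval 0), hae, hbe]
    simp [two_mul]
  have key : ∀ t : unitInterval, 0 < (t : ℝ) → (t : ℝ) < s →
      2 * (ENNReal.ofReal (1 - t) * (c ^ p * m E)) ≤
        (2 * (c * m E)) ^ p * (m (cthickening (t * L) E)) ^ (1 - p) := by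
    intro t ht hts
    have hab : a.map (eval t) ⟂ₘ b.map (eval t) :=
      (sing_prop H h h0 h1 ht hts hs1 hsing).mono (mapmono ha t) (mapmono hb' t)
    have I1 := le_self_add.trans (cd_two H oa (map_ac la h0) (map_ac la h1) t hN' hN1)
    have I2 := le_self_add.trans (cd_two H ob (map_ac lb h0) (map_ac lb h1) t hN' hN1)
    rw [← hp, hae, hFF] at I1
    rw [← hp, hbe, hFF] at I2
    rw [two_mul (ENNReal.ofReal (1 - (t : ℝ)) * (c ^ p * m E))]
    refine (add_le_add I1 I2).trans ?_
    rw [← FF_add m hp0 _ _ hab, ← Measure.map_add _ _ (measurable_eval t), ← hmass,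
      ← mass_map (a + b) (measurable_eval t)]
    refine FF_le m hp0 hp1 _ isClosed_cthickening.measurableSet ?_
    refine (ae_map_eval (p := fun y => y ∈ cthickening (t * L) E)
      isClosed_cthickening.measurableSet).1 ?_
    filter_upwards [hE0, hLd] with γ g1 g2
    refine mem_cthickening_of_dist_le _ _ _ _ g1 ?_
    rw [geo_dist]
    have : |((t : unitInterval) : ℝ) - ((0 : unitInterval) : ℝ)| = t := by
      simp [abs_of_nonneg t.2.1]
    rw [this]
    gcongr
  let T : ℕ → unitInterval := fun n => ⟨(s : ℝ) / (n + 2), by positivity, by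
    rw [div_le_one (by positivity)]; linarith [(Nat.cast_nonneg n : (0 : ℝ) ≤ n)]⟩
  have hT : Filter.Tendsto (fun n => (T n : ℝ)) Filter.atTop (nhds 0) :=
    Filter.Tendsto.div_atTop tendsto_const_nhds
      (Filter.tendsto_atTop_add_const_right _ _ tendsto_natCast_atTop_atTop)
  have lim1 : Filter.Tendsto (fun n => 2 * (ENNReal.ofReal (1 - T n) * (c ^ p * m E))) Filter.atTop
      (nhds (2 * (1 * (c ^ p * m E)))) := by
    have hcp : c ^ p * m E ≠ ⊤ := ENNReal.mul_ne_top (ENNReal.rpow_ne_top_of_nonneg hp0.le hct) hmEt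
    refine ENNReal.Tendsto.const_mul (ENNReal.Tendsto.mul_const ?_ (Or.inr hcp)) (Or.inr (by simp))
    have := (ENNReal.continuous_ofReal.tendsto (1 - 0)).comp (tendsto_const_nhds.sub hT)
    simpa [Function.comp_def] using this
  have lim2 : Filter.Tendsto (fun n => (2 * (c * m E)) ^ p * (m (cthickening (T n * L) E)) ^ (1 - p))
      Filter.atTop (nhds ((2 * (c * m E)) ^ p * (m E) ^ (1 - p))) := by
    refine ENNReal.Tendsto.const_mul ?_ (Or.inr (ENNReal.rpow_ne_top_of_nonneg hp0.le
      (ENNReal.mul_ne_top (by simp) (ENNReal.mul_ne_top hct hmEt))))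
    refine ((ENNReal.continuous_rpow_const (y := 1 - p)).tendsto _).comp ?_
    have := tendsto_measure_cthickening (μ := m) (s := E) ⟨1, one_pos, H.bdd _ hEb.cthickening⟩
    rw [hEc.closure_eq] at this
    refine this.comp ?_
    simpa using hT.mul_const L
  have fin := le_of_tendsto_of_tendsto' lim1 lim2 (fun n => key (T n) (by
    show 0 < (s : ℝ) / (n + 2); positivity) (by
    show (s : ℝ) / (n + 2) < s
    rw [div_lt_iff₀ (by positivity)]
    nlinarith [(Nat.cast_nonneg n : (0 : ℝ) ≤ n)]))
  have e : (2 * (c * m E)) ^ p * (m E) ^ (1 - p) = 2 ^ p * (c ^ p * m E) := by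
    rw [ENNReal.mul_rpow_of_nonneg _ _ hp0.le, ENNReal.mul_rpow_of_nonneg _ _ hp0.le, mul_assoc,
      mul_assoc, ← ENNReal.rpow_add _ _ hmE hmEt]
    simp
  rw [e, one_mul, ENNReal.mul_le_mul_iff_left (mul_ne_zero (by simp [hc0, hct]) hmE)
    (ENNReal.mul_ne_top (ENNReal.rpow_ne_top_of_nonneg hp0.le hct) hmEt)] at fin
  have e2 : (2 : ℝ≥0∞) ^ p < 2 ^ (1 : ℝ) :=
    ENNReal.rpow_lt_rpow_of_exponent_lt (by norm_num) (by simp) hp1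
  rw [ENNReal.rpow_one] at e2
  exact absurd fin (not_le.2 e2)

theorem good_part (H : Hyp m N) {θ : Measure (Geo X)} (h : MOpt θ) (h0 : θ.map (eval 0) ≪ m)
    (hne : θ ≠ 0) {r : unitInterval} (hr : (r : ℝ) < 1) :
    ∃ θ' : Measure (Geo X), MOpt θ' ∧ θ'.map (eval 0) = θ.map (eval 0) ∧
      θ'.map (eval 1) = θ.map (eval 1) ∧ ∃ g ≤ θ', g ≠ 0 ∧ g.map (eval r) ≪ m := by
  have hf := h.1
  obtain ⟨θ', a, b, c, d⟩ := cd_mass_time H h h0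
  have hf' := a.1
  refine ⟨θ', a, b, c, ?_⟩
  obtain ⟨g, hg, hge⟩ := lift_sub (measurable_eval r) θ' _
    (Measure.withDensity_rnDeriv_le (θ'.map (eval r)) m)
  refine ⟨g, hg, ?_, hge ▸ withDensity_absolutelyContinuous _ _⟩
  rintro rfl
  have h1 : m.withDensity ((θ'.map (eval r)).rnDeriv m) univ = 0 := by rw [← hge]; simp
  rw [withDensity_apply _ MeasurableSet.univ, Measure.restrict_univ] at h1
  have h2 := d r
  rw [h1, nonpos_iff_eq_zero, mul_eq_zero, ENNReal.ofReal_eq_zero] at h2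
  rcases h2 with h2 | h2
  · linarith
  · exact hne (Measure.measure_univ_eq_zero.1 h2)

end

section
variable [BorelSpace X] [StandardBorelSpace X] [TopologicalSpace.SeparableSpace X] [Nonempty X]
variable {m : Measure X} [SigmaFinite m] {N : ℝ}

theorem nz_of_map {a b : Measure (Geo X)} (h : a.map (eval 0) = b.map (eval 0)) (hb : b ≠ 0) :
    a ≠ 0 := by
  rintro rfl
  apply hb
  apply zero_of_map (measurable_eval 0)
  rw [← h]; simp

theorem sep_zero (H : Hyp m N) {θ₁ θ₂ : Measure (Geo X)} (h : MOpt (θ₁ + θ₂))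
    (he : θ₁.map (eval 0) = θ₂.map (eval 0)) (h0 : θ₁.map (eval 0) ≪ m)
    {U₁ U₂ : Set X} (hm₁ : MeasurableSet U₁) (hm₂ : MeasurableSet U₂) {δ : ℝ} (hδ : 0 < δ)
    (hsep : ∀ x ∈ U₁, ∀ y ∈ U₂, δ ≤ dist x y)
    (hU₁ : ∀ᵐ γ ∂θ₁, eval 1 γ ∈ U₁) (hU₂ : ∀ᵐ γ ∂θ₂, eval 1 γ ∈ U₂) : θ₁ = 0 := by
  by_contra hne
  have o₁ := h.sub (Measure.le_add_right le_rfl : θ₁ ≤ θ₁ + θ₂)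
  have o₂ := h.sub (Measure.le_add_left le_rfl : θ₂ ≤ θ₁ + θ₂)
  have f₁ := o₁.1
  have f₂ := o₂.1
  obtain ⟨x, R, hb⟩ := h.2.1
  rw [ae_add_measure_iff] at hb
  obtain ⟨hb1, hb2⟩ := hb
  have hcm : MeasurableSet {y : X | dist y x ≤ R} := isClosed_closedBall.measurableSet
  set L : ℝ := max (2 * R) 1 with hL
  have hL0 : 0 < L := by rw [hL]; positivity
  have hLd : ∀ γ : Geo X, dist (eval 0 γ) x ≤ R → dist (eval 1 γ) x ≤ R →
      dist (eval 0 γ) (eval 1 γ) ≤ L := fun γ g0 g1 =>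
    (dist_triangle_right _ _ x).trans (by linarith [le_max_left (2 * R) 1])
  set ε : ℝ := min (1 / 2) (δ / (6 * L)) with hε
  have hε0 : 0 < ε := by rw [hε]; positivity
  have hε1 : ε ≤ 1 / 2 := min_le_left _ _
  have hε2 : ε * (6 * L) ≤ δ := by
    rw [← le_div_iff₀ (by positivity)]; exact min_le_right _ _
  let r : unitInterval := ⟨1 - ε, by linarith, by linarith⟩
  have hr : (r : ℝ) = 1 - ε := rfl
  have hr0 : 0 < (r : ℝ) := by rw [hr]; linarith
  have hr1 : (r : ℝ) < 1 := by rw [hr]; linarith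
  obtain ⟨θ₁', a1, a2, a3, g₁, hg₁, hg₁0, hg₁r⟩ := good_part H o₁ h0 hne hr1
  have fθ1' := a1.1
  have O1 : MOpt (θ₁' + θ₂) := h.swap a1 o₂ a2 a3 rfl rfl
  obtain ⟨θm, hθm, hθme⟩ := lift_sub (measurable_eval 0) θ₂ (g₁.map (eval 0))
    (by rw [← he, ← a2]; exact mapmono hg₁ 0)
  have O2 : MOpt (g₁ + θm) := O1.sub (add_le_add hg₁ hθm)
  have oθm : MOpt θm := O2.sub (Measure.le_add_left le_rfl)
  have og1 : MOpt g₁ := O2.sub (Measure.le_add_right le_rfl)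
  have fg1 := og1.1
  have hg10 : g₁.map (eval 0) ≪ m := map_ac hg₁ (a2 ▸ h0)
  obtain ⟨θ₂', b1, b2, b3, g₂, hg₂, hg₂0, hg₂r⟩ := good_part H oθm (by rw [hθme]; exact hg10)
    (nz_of_map hθme hg₁0) hr1
  have O3 : MOpt (g₁ + θ₂') := O2.swap og1 b1 rfl rfl b2 b3
  obtain ⟨α, hα, hαe⟩ := lift_sub (measurable_eval 0) g₁ (g₂.map (eval 0))
    (by rw [← hθme, ← b2]; exact mapmono hg₂ 0)
  have O4 : MOpt (α + g₂) := O3.sub (add_le_add hα hg₂)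
  have hα0 : α ≠ 0 := nz_of_map hαe hg₂0
  -- bounds
  have la : ∀ᵐ γ ∂α, eval 1 γ ∈ U₁ ∧ dist (eval 0 γ) (eval 1 γ) ≤ L := by
    have l1 : α.map (eval 1) ≤ θ₁.map (eval 1) := a3 ▸ mapmono (hα.trans hg₁) 1
    have l0 : α.map (eval 0) ≤ θ₁.map (eval 0) := a2 ▸ mapmono (hα.trans hg₁) 0
    filter_upwards [ae_transfer l1 (p := fun y => y ∈ U₁) hm₁ hU₁,
      ae_transfer l1 (p := fun y => dist y x ≤ R) hcm (hb1.mono fun γ h => h.2),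
      ae_transfer l0 (p := fun y => dist y x ≤ R) hcm (hb1.mono fun γ h => h.1)] with γ c1 c2 c3
    exact ⟨c1, hLd γ c3 c2⟩
  have lb : ∀ᵐ γ ∂g₂, eval 1 γ ∈ U₂ ∧ dist (eval 0 γ) (eval 1 γ) ≤ L := by
    have l1 : g₂.map (eval 1) ≤ θ₂.map (eval 1) := (mapmono hg₂ 1).trans (b3 ▸ mapmono hθm 1)
    have l0 : g₂.map (eval 0) ≤ θ₂.map (eval 0) := (mapmono hg₂ 0).trans (b2 ▸ mapmono hθm 0)
    filter_upwards [ae_transfer l1 (p := fun y => y ∈ U₂) hm₂ hU₂,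
      ae_transfer l1 (p := fun y => dist y x ≤ R) hcm (hb2.mono fun γ h => h.2),
      ae_transfer l0 (p := fun y => dist y x ≤ R) hcm (hb2.mono fun γ h => h.1)] with γ c1 c2 c3
    exact ⟨c1, hLd γ c3 c2⟩
  have close : ∀ γ : Geo X, dist (eval 0 γ) (eval 1 γ) ≤ L →
      dist (eval (r * r) γ) (eval 1 γ) ≤ δ / 3 := by
    intro γ hγ
    rw [geo_dist]
    have e : |((r * r : unitInterval) : ℝ) - ((1 : unitInterval) : ℝ)| ≤ 2 * ε := by
      rw [show ((r * r : unitInterval) : ℝ) = (1 - ε) * (1 - ε) from rfl,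
        show ((1 : unitInterval) : ℝ) = 1 from rfl, abs_le]
      constructor <;> nlinarith
    calc _ ≤ 2 * ε * L := by gcongr
      _ ≤ δ / 3 := by linarith
  have hsing : (α.map (rest r)).map (eval r) ⟂ₘ (g₂.map (rest r)).map (eval r) := by
    rw [map_eval_rest, map_eval_rest]
    refine ⟨(thickening (δ / 2) U₁)ᶜ, isOpen_thickening.measurableSet.compl, ?_, ?_⟩
    · refine (ae_map_eval (p := fun y => y ∈ thickening (δ / 2) U₁)
        isOpen_thickening.measurableSet).1 ?_
      filter_upwards [la] with γ hγ
      exact mem_thickening_iff.2 ⟨_, hγ.1, (close γ hγ.2).trans_lt (by linarith)⟩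
    · refine (ae_map_eval (p := fun y => y ∈ (thickening (δ / 2) U₁)ᶜ)
        isOpen_thickening.measurableSet.compl).1 ?_
      filter_upwards [lb] with γ hγ hmem
      obtain ⟨u, hu, hud⟩ := mem_thickening_iff.1 hmem
      have h1 := hsep u hu _ hγ.1
      have h2 := dist_triangle_left u (eval 1 γ) (eval (r * r) γ)
      have h3 := close γ hγ.2
      linarith
  have O5 : MOpt (α.map (rest r) + g₂.map (rest r)) := by
    rw [← Measure.map_add _ _ (measurable_rest r)]
    exact O4.rest H.plans r hr0 hr1
  have z := core_sep H O5 (by rw [map_eval_rest, map_eval_rest, mul_zero, hαe])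
    (by
      rw [Measure.map_add _ _ (measurable_eval _), map_eval_rest, map_eval_rest, mul_zero, hαe]
      have : g₂.map (eval 0) ≪ m := by rw [← hαe]; exact map_ac hα hg10
      exact this.add_left this)
    (by
      rw [Measure.map_add _ _ (measurable_eval _), map_eval_rest, map_eval_rest, mul_one]
      exact (map_ac hα hg₁r).add_left hg₂r)
    hr0 hr1 hsing
  exact hα0 (zero_of_map (measurable_rest r) z)

theorem ac_interior (H : Hyp m N) {π : Measure (Geo X)} (h : MOpt π) (h0 : π.map (eval 0) ≪ m)
    {r : unitInterval} (hr0 : 0 < (r : ℝ)) (hr1 : (r : ℝ) < 1) : π.map (eval r) ≪ m := by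
  by_contra hcon
  have hf := h.1
  have hA : ∃ A, MeasurableSet A ∧ m A = 0 ∧ π.map (eval r) A ≠ 0 := by
    by_contra hA
    push Not at hA
    exact hcon (Measure.AbsolutelyContinuous.mk fun s hs hms => hA s hs hms)
  obtain ⟨A, hA, hmA, hpA⟩ := hA
  obtain ⟨K, hKA, hK, hKp⟩ := hA.exists_lt_isClosed_of_ne_top (measure_ne_top (π.map (eval r)) _)
    (pos_iff_ne_zero.2 hpA)
  have hmK : m K = 0 := measure_mono_null hKA hmA
  have hKm : MeasurableSet (eval r ⁻¹' K : Set (Geo X)) := measurable_eval r hK.measurableSet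
  rw [Measure.map_apply (measurable_eval r) hK.measurableSet] at hKp
  have hKne : K.Nonempty := by
    by_contra hK0
    rw [not_nonempty_iff_eq_empty] at hK0
    simp [hK0] at hKp
  set π₁ := π.restrict (eval r ⁻¹' K) with hπ₁
  have l₁ : π₁ ≤ π := Measure.restrict_le_self
  have o₁ := h.sub l₁
  have f₁ := o₁.1
  have hne : π₁ ≠ 0 := by
    rw [hπ₁, Ne, Measure.restrict_eq_zero]; exact hKp.ne'
  obtain ⟨θ, a1, a2, a3, g, hg, hg0, hgr⟩ := good_part H o₁ (map_ac l₁ h0) hne hr1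
  have fθ := a1.1
  have O1 : MOpt (π₁ + π₁) := by
    rw [← two_smul ℝ≥0∞]; exact o₁.smul (by simp)
  have O2 : MOpt (π₁ + θ) := O1.swap o₁ a1 rfl rfl a2 a3
  let V : ℕ → Set X := fun n => {y | 1 / ((n : ℝ) + 1) ≤ infDist y K}
  have hV : ∀ n, MeasurableSet (V n) := fun n =>
    (isClosed_le continuous_const (continuous_infDist_pt K)).measurableSet
  have hn : ∃ n, g (eval r ⁻¹' V n) ≠ 0 := by
    by_contra hc
    push Not at hc
    have u1 : g (⋃ n, eval r ⁻¹' V n) = 0 := measure_iUnion_null hc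
    have u2 : g (eval r ⁻¹' K) = 0 := by
      rw [← Measure.map_apply (measurable_eval r) hK.measurableSet]; exact hgr hmK
    apply hg0
    rw [← Measure.measure_univ_eq_zero]
    refine measure_mono_null ?_ (measure_union_null u1 u2)
    intro γ _
    by_cases hγ : eval r γ ∈ K
    · exact Or.inr hγ
    · left
      have hpos : 0 < infDist (eval r γ) K := (hK.notMem_iff_infDist_pos hKne).1 hγ
      obtain ⟨n, hn⟩ := exists_nat_one_div_lt hpos
      exact mem_iUnion.2 ⟨n, hn.le⟩
  obtain ⟨n, hn⟩ := hn
  have hVm : MeasurableSet (eval r ⁻¹' V n : Set (Geo X)) := measurable_eval r (hV n)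
  set b := g.restrict (eval r ⁻¹' V n) with hb
  have hbg : b ≤ g := Measure.restrict_le_self
  have hb0 : b ≠ 0 := by rw [hb, Ne, Measure.restrict_eq_zero]; exact hn
  obtain ⟨a, ha, hae⟩ := lift_sub (measurable_eval 0) π₁ (b.map (eval 0))
    (by rw [← a2]; exact mapmono (hbg.trans hg) 0)
  have O3 : MOpt (a + b) := O2.sub (add_le_add ha (hbg.trans hg))
  have O4 : MOpt (a.map (rest r) + b.map (rest r)) := by
    rw [← Measure.map_add _ _ (measurable_rest r)]
    exact O3.rest H.plans r hr0 hr1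
  have z := sep_zero H O4 (by rw [map_eval_rest, map_eval_rest, mul_zero, hae])
    (by rw [map_eval_rest, mul_zero]; exact map_ac (ha.trans l₁) h0)
    hK.measurableSet (hV n) (δ := 1 / ((n : ℝ) + 1)) (by positivity)
    (fun x hx y hy => le_trans hy (by rw [dist_comm]; exact infDist_le_dist_of_mem hx))
    (by
      rw [ae_map_eval (p := fun y => y ∈ K) hK.measurableSet, map_eval_rest, mul_one,
        ← ae_map_eval (p := fun y => y ∈ K) hK.measurableSet]
      exact Measure.absolutelyContinuous_of_le ha (ae_restrict_mem hKm))
    (by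
      rw [ae_map_eval (p := fun y => y ∈ V n) (hV n), map_eval_rest, mul_one,
        ← ae_map_eval (p := fun y => y ∈ V n) (hV n)]
      exact ae_restrict_mem hVm)
  exact nz_of_map hae hb0 (zero_of_map (measurable_rest r) z)

end

section
variable [BorelSpace X] [StandardBorelSpace X] [TopologicalSpace.SeparableSpace X] [Nonempty X]
variable {m : Measure X} [SigmaFinite m] {N : ℝ}

theorem rnDeriv_le_of_le {μ : Measure X} [IsFiniteMeasure μ] {c : ℝ≥0∞}
    (h : μ ≤ c • m) : ∀ᵐ x ∂m, μ.rnDeriv m x ≤ c := by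
  have hac : μ ≪ m := (Measure.absolutelyContinuous_of_le h).trans Measure.smul_absolutelyContinuous
  refine ae_le_of_forall_setLIntegral_le_of_sigmaFinite (Measure.measurable_rnDeriv _ _)
    (fun s hs _ => ?_)
  rw [Measure.setLIntegral_rnDeriv hac, setLIntegral_const]
  exact h s

theorem dens_ac (H : Hyp m N) {π : Measure (Geo X)} (h : MOpt π) {C : ℝ} (hC : 0 < C)
    (h0 : π.map (eval 0) ≤ ENNReal.ofReal C • m) (h1 : π.map (eval 1) ≪ m)
    {t : unitInterval} (ht : (t : ℝ) < 1) {N' : ℝ} (hN' : N ≤ N') (hN1 : 1 < N') :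
    π.map (eval t) ≤ ENNReal.ofReal (C * (1 - (t : ℝ)) ^ (-N')) • m := by
  have hf := h.1
  have ht0 : 0 < 1 - (t : ℝ) := by linarith
  set D := ENNReal.ofReal (C * (1 - (t : ℝ)) ^ (-N')) with hD
  have hDpos : 0 < C * (1 - (t : ℝ)) ^ (-N') := by positivity
  have h0' : π.map (eval 0) ≪ m :=
    (Measure.absolutelyContinuous_of_le h0).trans Measure.smul_absolutelyContinuous
  set ν := π.map (eval t) with hν
  have hνac : ν ≪ m := cd_ac_time H h h0' h1 t
  have hρm : Measurable (ν.rnDeriv m) := Measure.measurable_rnDeriv _ _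
  suffices hs : ∀ᵐ x ∂m, ν.rnDeriv m x ≤ D by
    rw [← Measure.withDensity_rnDeriv_eq ν m hνac, ← withDensity_const]
    exact withDensity_mono hs
  by_contra hcon
  set B : Set X := {x | D < ν.rnDeriv m x} with hB
  have hBm : MeasurableSet B := measurableSet_lt measurable_const hρm
  have hmB : m B ≠ 0 := by
    intro hz
    apply hcon
    show m {x | ¬ (ν.rnDeriv m x ≤ D)} = 0
    simpa [not_le] using hz
  have hνB : ν B ≠ 0 := by
    rw [← Measure.setLIntegral_rnDeriv hνac]
    intro hz
    rw [lintegral_eq_zero_iff hρm, Filter.EventuallyEq, ae_restrict_iff' hBm] at hz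
    apply hmB
    refine measure_mono_null ?_ hz
    intro x hx hx'
    have := hx' hx
    have hx2 : D < ν.rnDeriv m x := hx
    rw [this] at hx2
    exact absurd hx2 (by simp)
  set a := π.restrict (eval t ⁻¹' B) with ha
  have la : a ≤ π := Measure.restrict_le_self
  have oa := h.sub la
  have fa := oa.1
  have hat : a.map (eval t) = ν.restrict B := by
    rw [ha, hν, Measure.restrict_map (measurable_eval t) hBm]
  have I1 := le_self_add.trans (cd_two H oa (map_ac la h0') (map_ac la h1) t hN' hN1)
  have hN0 : 0 < N' := by linarith
  have hq0 : 0 < 1 / N' := by positivity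
  have hq1 : 1 / N' < 1 := by rw [div_lt_one hN0]; exact hN1
  have hmass : a univ = ν B := by
    rw [← mass_map a (measurable_eval t), hat, Measure.restrict_apply_univ]
  -- lower bound at time zero
  have J0 : (ENNReal.ofReal C) ^ (-(1 / N')) * ν B ≤ FF m (1 - 1 / N') (a.map (eval 0)) := by
    rw [← FF_eq m _ hq1 _ (map_ac la h0'), ← hmass, ← mass_map a (measurable_eval 0),
      ← lintegral_const]
    refine lintegral_mono_ae ?_
    filter_upwards [map_ac la h0' (rnDeriv_le_of_le ((mapmono la 0).trans h0))] with x hx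
    rw [ENNReal.rpow_neg, ENNReal.rpow_neg, ENNReal.inv_le_inv]
    exact ENNReal.rpow_le_rpow hx hq0.le
  have hDne : D ≠ 0 := by rw [hD, Ne, ENNReal.ofReal_eq_zero, not_le]; exact hDpos
  have Jt : FF m (1 - 1 / N') (a.map (eval t)) < D ^ (-(1 / N')) * ν B := by
    have hle : ∀ᵐ x ∂(ν.restrict B), ((ν.restrict B).rnDeriv m x) ^ (-(1 / N')) < D ^ (-(1 / N')) := by
      have hacB : ν.restrict B ≪ m := Measure.restrict_le_self.absolutelyContinuous.trans hνac
      filter_upwards [hacB (Measure.rnDeriv_restrict ν m hBm), ae_restrict_mem hBm] with x hx hxB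
      rw [hx, indicator_of_mem hxB, ENNReal.rpow_neg, ENNReal.rpow_neg, ENNReal.inv_lt_inv]
      exact ENNReal.rpow_lt_rpow hxB hq0
    have hacB : ν.restrict B ≪ m := Measure.restrict_le_self.absolutelyContinuous.trans hνac
    have hfin := FF_fin H oa (p := 1 - 1 / N') (by linarith) (by linarith) t
    rw [hat] at hfin ⊢
    rw [← FF_eq m _ hq1 _ hacB] at hfin ⊢
    have e : D ^ (-(1 / N')) * ν B = ∫⁻ _, D ^ (-(1 / N')) ∂(ν.restrict B) := by
      rw [lintegral_const, Measure.restrict_apply_univ]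
    rw [e]
    refine lintegral_strict_mono ?_ aemeasurable_const hfin hle
    rw [Ne, Measure.restrict_eq_zero]; exact hνB
  have hDq : D ^ (-(1 / N')) = ENNReal.ofReal (1 - (t : ℝ)) * (ENNReal.ofReal C) ^ (-(1 / N')) := by
    rw [hD, ENNReal.ofReal_rpow_of_pos hDpos, ENNReal.ofReal_rpow_of_pos hC,
      ← ENNReal.ofReal_mul ht0.le, Real.mul_rpow hC.le (by positivity), ← Real.rpow_mul ht0.le,
      mul_comm]
    congr 2
    rw [show -N' * -(1 / N') = 1 by field_simp, Real.rpow_one]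
  have := ((mul_le_mul_right J0 (ENNReal.ofReal (1 - (t : ℝ)))).trans I1).trans_lt Jt
  rw [hDq, mul_assoc] at this
  exact lt_irrefl _ this

theorem dens_gen (H : Hyp m N) {π : Measure (Geo X)} (h : MOpt π) {C : ℝ} (hC : 0 < C)
    (h0 : π.map (eval 0) ≤ ENNReal.ofReal C • m)
    {t : unitInterval} (ht0 : 0 < (t : ℝ)) (ht : (t : ℝ) < 1) :
    π.map (eval t) ≤ ENNReal.ofReal (C * (1 - (t : ℝ)) ^ (-N)) • m := by
  have h0' : π.map (eval 0) ≪ m :=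
    (Measure.absolutelyContinuous_of_le h0).trans Measure.smul_absolutelyContinuous
  have step : ∀ (r : ℝ) (N' : ℝ), (t : ℝ) < r → r < 1 → N ≤ N' → 1 < N' →
      π.map (eval t) ≤ ENNReal.ofReal (C * (1 - (t : ℝ) / r) ^ (-N')) • m := by
    intro r N' htr hr1 hN' hN1
    have hr0 : 0 < r := ht0.trans htr
    let b : unitInterval := ⟨r, hr0.le, hr1.le⟩
    let u : unitInterval := ⟨(t : ℝ) / r, by positivity, by rw [div_le_one hr0]; exact htr.le⟩
    have hr := h.rest H.plans b hr0 hr1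
    have eu : (π.map (rest b)).map (eval u) = π.map (eval t) := by
      rw [map_eval_rest]; congr 2
      apply Subtype.ext
      show r * ((t : ℝ) / r) = t
      field_simp
    have := dens_ac H hr hC (by rw [map_eval_rest, mul_zero]; exact h0)
      (by rw [map_eval_rest, mul_one]; exact ac_interior H h h0' hr0 hr1) (t := u)
      (by show (t : ℝ) / r < 1; rw [div_lt_one hr0]; exact htr) hN' hN1
    rw [eu] at this
    exact this
  have ht1 : 0 < 1 - (t : ℝ) := by linarith
  refine Measure.le_iff.2 fun A hA => ?_
  let d : ℕ → ℝ := fun n => 1 / ((n : ℝ) + 2)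
  have hd0 : ∀ n, 0 < d n := fun n => by simp only [d]; positivity
  have hd1 : ∀ n, d n < 1 := fun n => by
    simp only [d]; rw [div_lt_one (by positivity)]; linarith [(Nat.cast_nonneg n : (0 : ℝ) ≤ n)]
  have hd : Filter.Tendsto d Filter.atTop (nhds 0) :=
    Filter.Tendsto.div_atTop tendsto_const_nhds
      (Filter.tendsto_atTop_add_const_right _ _ tendsto_natCast_atTop_atTop)
  have hlim : Filter.Tendsto (fun n => C * (1 - (t : ℝ) / (1 - (1 - t) * d n)) ^ (-(N + d n)))
      Filter.atTop (nhds (C * (1 - (t : ℝ)) ^ (-N))) := by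
    refine Filter.Tendsto.const_mul C ?_
    have b1 : Filter.Tendsto (fun n => 1 - (t : ℝ) / (1 - (1 - t) * d n)) Filter.atTop
        (nhds (1 - (t : ℝ))) := by
      have : Filter.Tendsto (fun n => 1 - (t : ℝ) / (1 - (1 - t) * d n)) Filter.atTop
          (nhds (1 - (t : ℝ) / (1 - (1 - t) * 0))) :=
        tendsto_const_nhds.sub (tendsto_const_nhds.div (tendsto_const_nhds.sub (hd.const_mul _))
          (by simp))
      simpa using this
    have b2 : Filter.Tendsto (fun n => -(N + d n)) Filter.atTop (nhds (-N)) := by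
      simpa using (hd.const_add N).neg
    exact b1.rpow b2 (Or.inl ht1.ne')
  have hlim2 := ENNReal.Tendsto.mul_const (b := m A)
    ((ENNReal.continuous_ofReal.tendsto _).comp hlim)
    (Or.inl (by rw [Ne, ENNReal.ofReal_eq_zero, not_le]; positivity))
  refine ge_of_tendsto' hlim2 fun n => ?_
  have := step (1 - (1 - t) * d n) (N + d n) (by nlinarith [hd1 n]) (by nlinarith [hd0 n])
    (by linarith [hd0 n]) (by linarith [hd0 n, H.hN]) A
  exact this

theorem opt_cost_fin {μ ν : Measure X} {π : Measure (Geo X)} (h : IsOptGeo μ ν π)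
    (hμ : HasFiniteSecondMoment μ) (hν : HasFiniteSecondMoment ν) : transportCost π ≠ ⊤ := by
  obtain ⟨hp, h0, h1, _⟩ := h
  obtain ⟨x, hx⟩ := hμ
  obtain ⟨y, hy⟩ := hν
  rw [← h0, lintegral_map (by fun_prop) (measurable_eval 0)] at hx
  rw [← h1, lintegral_map (by fun_prop) (measurable_eval 1)] at hy
  have hle : transportCost π ≤ ∫⁻ γ, (3 * ENNReal.ofReal (dist (eval 0 γ) x ^ 2) +
      (3 * ENNReal.ofReal (dist (eval 1 γ) y ^ 2) + 3 * ENNReal.ofReal (dist x y ^ 2))) ∂π := by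
    refine lintegral_mono fun γ => ?_
    have e3 : (3 : ℝ≥0∞) = ENNReal.ofReal 3 := by simp
    rw [e3, ← ENNReal.ofReal_mul (by norm_num), ← ENNReal.ofReal_mul (by norm_num),
      ← ENNReal.ofReal_mul (by norm_num), ← ENNReal.ofReal_add (by positivity) (by positivity),
      ← ENNReal.ofReal_add (by positivity) (by positivity)]
    apply ENNReal.ofReal_le_ofReal
    have h1 : dist (eval 0 γ) (eval 1 γ) ≤ dist (eval 0 γ) x + dist x y + dist (eval 1 γ) y := by
      have := dist_triangle4 (eval 0 γ) x y (eval 1 γ)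
      rwa [dist_comm y] at this
    have h2 : dist (eval 0 γ) (eval 1 γ) ^ 2 ≤
      (dist (eval 0 γ) x + dist x y + dist (eval 1 γ) y) ^ 2 := by gcongr
    nlinarith [sq_nonneg (dist (eval 0 γ) x - dist x y), sq_nonneg (dist (eval 1 γ) y - dist x y),
      sq_nonneg (dist (eval 0 γ) x - dist (eval 1 γ) y)]
  refine ne_top_of_le_ne_top ?_ hle
  have ms : ∀ (t : unitInterval) (z : X),
      Measurable fun γ : Geo X => ENNReal.ofReal (dist (eval t γ) z ^ 2) := fun t z =>
    (ENNReal.continuous_ofReal.comp (((continuous_eval t).dist continuous_const).pow 2)).measurable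
  rw [lintegral_add_left ((ms 0 x).const_mul _), lintegral_add_left ((ms 1 y).const_mul _),
    lintegral_const_mul _ (ms 0 x), lintegral_const_mul _ (ms 1 y), lintegral_const]
  refine ENNReal.add_ne_top.2 ⟨ENNReal.mul_ne_top (by simp) hx,
    ENNReal.add_ne_top.2 ⟨ENNReal.mul_ne_top (by simp) hy, ?_⟩⟩
  exact ENNReal.mul_ne_top (ENNReal.mul_ne_top (by simp) ENNReal.ofReal_ne_top) (measure_ne_top _ _)

theorem opt_restrict {μ ν : Measure X} {π : Measure (Geo X)} (h : IsOptGeo μ ν π)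
    (hc : transportCost π ≠ ⊤) {G : Set (Geo X)} (hG : MeasurableSet G)
    (hb : BddPlan (π.restrict G)) : MOpt (π.restrict G) := by
  obtain ⟨hp, h0, h1, ho⟩ := h
  refine ⟨inferInstance, hb, fun θ a b => ?_⟩
  have e : π.restrict G + π.restrict Gᶜ = π := Measure.restrict_add_restrict_compl hG
  have hm : ∀ t : unitInterval, θ.map (eval t) = (π.restrict G).map (eval t) →
      (θ + π.restrict Gᶜ).map (eval t) = π.map (eval t) := fun t ht => by
    rw [Measure.map_add _ _ (measurable_eval t), ht, ← Measure.map_add _ _ (measurable_eval t), e]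
  have hq : IsProbabilityMeasure (θ + π.restrict Gᶜ) := ⟨by
    rw [mass_eq (hm 0 a)]; exact measure_univ⟩
  have := ho (θ + π.restrict Gᶜ) hq ((hm 0 a).trans h0) ((hm 1 b).trans h1)
  rw [cost_add] at this
  have e2 : transportCost π = transportCost (π.restrict G) + transportCost (π.restrict Gᶜ) := by
    rw [← cost_add, e]
  rw [e2] at this hc
  exact (ENNReal.add_le_add_iff_right (ENNReal.add_ne_top.1 hc).2).1 this

theorem final_bound (H : Hyp m N) {μ ν : Measure X} (hμ2 : HasFiniteSecondMoment μ)
    (hν2 : HasFiniteSecondMoment ν) {C : ℝ} (hC : 0 < C) (hμC : μ ≤ ENNReal.ofReal C • m)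
    {π : Measure (Geo X)} (hπ : IsOptGeo μ ν π) {t : unitInterval} (ht : (t : ℝ) < 1) :
    π.map (eval t) ≤ ENNReal.ofReal (C * (1 - (t : ℝ)) ^ (-N)) • m := by
  by_cases ht0 : (t : ℝ) = 0
  · have e : t = 0 := Subtype.ext ht0
    subst e
    rw [hπ.2.1]; simpa using hμC
  have ht0' : 0 < (t : ℝ) := lt_of_le_of_ne t.2.1 (Ne.symm ht0)
  have x : X := Classical.arbitrary X
  let G : ℕ → Set (Geo X) := fun n => {γ | dist (eval 0 γ) x ≤ n ∧ dist (eval 1 γ) x ≤ n}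
  have hG : ∀ n, MeasurableSet (G n) := fun n =>
    ((isClosed_le ((continuous_eval 0).dist continuous_const) continuous_const).inter
      (isClosed_le ((continuous_eval 1).dist continuous_const) continuous_const)).measurableSet
  have hGm : Monotone G := fun i j hij γ hγ => by
    have : (i : ℝ) ≤ j := by exact_mod_cast hij
    exact ⟨hγ.1.trans this, hγ.2.trans this⟩
  have hGu : ⋃ n, G n = univ := eq_univ_of_forall fun γ => by
    obtain ⟨n, hn⟩ := exists_nat_ge (max (dist (eval 0 γ) x) (dist (eval 1 γ) x))
    exact mem_iUnion.2 ⟨n, (le_max_left _ _).trans hn, (le_max_right _ _).trans hn⟩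
  have hb : ∀ n, (π.restrict (G n)).map (eval t) ≤ ENNReal.ofReal (C * (1 - (t : ℝ)) ^ (-N)) • m := by
    intro n
    refine dens_gen H (opt_restrict hπ (opt_cost_fin hπ hμ2 hν2) (hG n) ⟨x, n, ?_⟩) hC ?_ ht0' ht
    · exact ae_restrict_mem (hG n)
    · refine (mapmono Measure.restrict_le_self 0).trans ?_
      rw [hπ.2.1]; exact hμC
  refine Measure.le_iff.2 fun A hA => ?_
  rw [Measure.map_apply (measurable_eval t) hA]
  have hAm : MeasurableSet (eval t ⁻¹' A : Set (Geo X)) := measurable_eval t hA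
  have e : eval t ⁻¹' A = ⋃ n, (eval t ⁻¹' A ∩ G n) := by
    rw [← inter_iUnion, hGu, inter_univ]
  have hmono : Monotone fun n => eval t ⁻¹' A ∩ G n := fun i j hij =>
    inter_subset_inter_right _ (hGm hij)
  rw [e, hmono.measure_iUnion]
  refine iSup_le fun n => ?_
  have := hb n A
  rwa [Measure.map_apply (measurable_eval t) hA, Measure.restrict_apply hAm] at this

end

/-- **Corollary 1.6, case `K = 0`**: if `μ ≤ C·m` then the interpolant at time `t` has density
bounded by `C·(1-t)^{-N}`. -/
theorem interpolant_density_bound_K_zero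
    [CompleteSpace X] [TopologicalSpace.SeparableSpace X] [ProperSpace X] [BorelSpace X]
    (hX : IsGeodesicSpace X) (m : Measure X)
    (hm_bdd : ∀ s : Set X, Bornology.IsBounded s → m s ≠ ⊤)
    (hm_supp : ∀ x : X, ∀ r : ℝ, 0 < r → 0 < m (ball x r))
    (N : ℝ) (hN : 1 ≤ N) (hCD : IsCDStar 0 N m) (hGT : GoodTransport m)
    (μ ν : Measure X) (hμp : IsProbabilityMeasure μ) (hνp : IsProbabilityMeasure ν)
    (hμ2 : HasFiniteSecondMoment μ) (hν2 : HasFiniteSecondMoment ν)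
    (C : ℝ) (hC : 0 < C) (hμC : μ ≤ ENNReal.ofReal C • m)
    (π : Measure (Geo X)) (hπ : IsOptGeo μ ν π) :
    ∀ t : unitInterval, (t : ℝ) < 1 →
      π.map (eval t) ≤ ENNReal.ofReal (C * (1 - (t : ℝ)) ^ (-N)) • m := by
  have : SecondCountableTopology X := UniformSpace.secondCountable_of_separable X
  have : IsFiniteMeasureOnCompacts m := ⟨fun K hK => (hm_bdd K hK.isBounded).lt_top⟩
  have : PolishSpace X := inferInstance
  have : StandardBorelSpace X := inferInstance
  have : SigmaFinite m := inferInstance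
  have : Nonempty X := ⟨hμ2.choose⟩
  exact fun t ht => final_bound ⟨hm_bdd, hN, hCD, hGT⟩ hμ2 hν2 hC hμC hπ ht

end
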